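/- arXiv:2604.01316 — 3 statements merged into one kernel-verified Lean document; each statement's English description precedes it below -/
import Mathlib

section
/- Let λ = 1+i in ℤ[i]. For c₁, c₂ ∈ ℤ[i] with c₁ ≡ c₂ ≡ 1 (mod λ³) and gcd(c₁, c₂) = 1, the quartic residue symbols satisfy (c₁/c₂)₄ = (-1)^C · (c₂/c₁)₄, where C = ((N(c₁)-1)/4) · ((N(c₂)-1)/4) and N denotes the norm. -/
noncomputable section

open scoped Classical
open Complex

abbrev Zi := GaussianInt

def lam : Zi := ⟨1, 1⟩

def Ni (x : Zi) : ℤ := Zsqrtd.norm x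

/-- ě(z) = e^{2πi (z + z̄)} -/
def eCheck (z : ℂ) : ℂ := Complex.exp (2 * Real.pi * Complex.I * (z + (starRingEnd ℂ) z))

/-- Quartic residue symbol at a prime modulus: the unique fourth root of unity
congruent to `α ^ ((N π - 1)/4)` modulo `π`. -/
def quarticPrime (α π : Zi) : Zi :=
  if h : ∃ u : Zi, u ^ 4 = 1 ∧ π ∣ α ^ ((Ni π - 1) / 4).toNat - u then h.choose else 0

/-- Quartic residue symbol `(α/γ)₄`, extended multiplicatively over the prime
factorization of `γ`, and declared `0` when `α, γ` are not coprime. -/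
def quarticSym (α γ : Zi) : ℂ :=
  if IsCoprime α γ then
    ((UniqueFactorizationMonoid.factors γ).map
      fun π => GaussianInt.toComplex (quarticPrime α π)).prod
  else 0

/-- Quadratic residue symbol `(α/γ)₂ = (α/γ)₄²`. -/
def quadSym (α γ : Zi) : ℂ := quarticSym α γ ^ 2

/-- Quartic Gauss sum `g₄(ν, c) = Σ_{d mod c} (d/c)₄ ě(ν d / c)`. -/
def g4 (ν : ℂ) (c : Zi) : ℂ :=
  ∑ᶠ x : Zi ⧸ Ideal.span {c},
    quarticSym (Quotient.out x) c *
      eCheck (ν * GaussianInt.toComplex (Quotient.out x) / GaussianInt.toComplex c)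

/-- Quadratic Gauss sum `g₂(ν, c) = Σ_{d mod c} (d/c)₂ ě(ν d / c)`. -/
def g2 (ν : ℂ) (c : Zi) : ℂ :=
  ∑ᶠ x : Zi ⧸ Ideal.span {c},
    quadSym (Quotient.out x) c *
      eCheck (ν * GaussianInt.toComplex (Quotient.out x) / GaussianInt.toComplex c)

/-- Euler totient on `ℤ[i]`. -/
def phiZ (c : Zi) : ℕ := Nat.card ((Zi ⧸ Ideal.span {c})ˣ)


open UniqueFactorizationMonoid

namespace Biquadratic

/-- The imaginary unit of `ℤ[i]`. -/
def iZ : Zi := ⟨0, 1⟩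

lemma iZ_mul_self : iZ * iZ = -1 := by decide

lemma iZ_pow_four : iZ ^ 4 = 1 := by decide

lemma isUnit_of_pow_four {u : Zi} (h : u ^ 4 = 1) : IsUnit u :=
  IsUnit.of_pow_eq_one h (by norm_num)

lemma mem_of_isUnit {u : Zi} (h : IsUnit u) : u = 1 ∨ u = -1 ∨ u = iZ ∨ u = -iZ := by
  have h1 := (Zsqrtd.norm_eq_one_iff' (by norm_num) u).2 h
  rw [Zsqrtd.norm_def] at h1
  obtain ⟨x, y⟩ := u
  simp only [Zsqrtd.ext_iff, iZ] at *
  have hx : -1 ≤ x ∧ x ≤ 1 := by constructor <;> nlinarith [mul_self_nonneg x, mul_self_nonneg y]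
  have hy : -1 ≤ y ∧ y ≤ 1 := by constructor <;> nlinarith [mul_self_nonneg x, mul_self_nonneg y]
  obtain ⟨a, b⟩ := hx
  obtain ⟨c, d⟩ := hy
  interval_cases x <;> interval_cases y <;> simp_all

lemma mul_star_of_pow_four {u : Zi} (h : u ^ 4 = 1) : u * star u = 1 := by
  rcases mem_of_isUnit (isUnit_of_pow_four h) with rfl | rfl | rfl | rfl <;> decide

lemma isUnit_of_odd_norm_dvd_four {π : Zi} (ho : Odd π.norm) (h : π.norm ∣ 4) : IsUnit π := by
  rw [← Zsqrtd.norm_eq_one_iff' (by norm_num)]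
  have h0 := GaussianInt.norm_nonneg π
  have h4 := Int.le_of_dvd (by norm_num) h
  interval_cases h : π.norm <;> revert ho <;> simp_all; decide

lemma norm_dvd_of_dvd {x y : Zi} (h : x ∣ y) : x.norm ∣ y.norm := by
  obtain ⟨z, rfl⟩ := h
  exact ⟨z.norm, Zsqrtd.norm_mul _ _⟩

lemma ne_zero_of_odd_norm {x : Zi} (h : Odd x.norm) : x ≠ 0 := by
  rintro rfl
  simp [Zsqrtd.norm_zero] at h

lemma eq_of_pow_four_of_dvd_sub {π u v : Zi} (hπ : ¬ IsUnit π) (ho : Odd π.norm)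
    (hu : u ^ 4 = 1) (hv : v ^ 4 = 1) (h : π ∣ u - v) : u = v := by
  by_contra hne
  refine hπ (isUnit_of_odd_norm_dvd_four ho ((norm_dvd_of_dvd h).trans ?_))
  rcases mem_of_isUnit (isUnit_of_pow_four hu) with rfl | rfl | rfl | rfl <;>
  rcases mem_of_isUnit (isUnit_of_pow_four hv) with rfl | rfl | rfl | rfl <;>
  first | exact absurd rfl hne | decide

/-- The standard `ℤ`-basis of `ℤ[i]`. -/
def basisZi : Module.Basis (Fin 2) ℤ Zi :=
  Module.Basis.ofEquivFun
    { toFun := fun z => ![z.re, z.im]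
      invFun := fun v => ⟨v 0, v 1⟩
      map_add' := fun x y => by ext i; fin_cases i <;> simp
      map_smul' := fun c x => by ext i; fin_cases i <;> simp
      left_inv := fun z => by simp
      right_inv := fun v => by ext i; fin_cases i <;> simp }

instance : Module.Free ℤ Zi := Module.Free.of_basis basisZi

instance : Module.Finite ℤ Zi := Module.Finite.of_basis basisZi

lemma algebraNorm_eq (z : Zi) : Algebra.norm ℤ z = z.norm := by
  rw [Algebra.norm_eq_matrix_det basisZi, Matrix.det_fin_two]
  simp [Algebra.leftMulMatrix_eq_repr_mul, basisZi, Zsqrtd.norm_def]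

lemma card_quotient (π : Zi) : Nat.card (Zi ⧸ Ideal.span {π}) = π.norm.natAbs := by
  rw [← algebraNorm_eq, ← Ideal.absNorm_span_singleton, Ideal.absNorm_apply,
    Submodule.cardQuot_apply]

lemma isMaximal_span {π : Zi} (hπ : Prime π) : (Ideal.span {π}).IsMaximal :=
  PrincipalIdealRing.isMaximal_of_irreducible hπ.irreducible

lemma natAbs_norm_mod_four {z : Zi} (h : Odd z.norm) : z.norm.natAbs % 4 = 1 := by
  have h0 := GaussianInt.norm_nonneg z
  have : z.norm % 4 = 1 := by
    rw [Zsqrtd.norm_def] at *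
    obtain ⟨x, y⟩ := z
    simp only at *
    have hx := Int.emod_nonneg x (b := 4) (by norm_num)
    have hx' := Int.emod_lt_of_pos x (b := 4) (by norm_num)
    have hy := Int.emod_nonneg y (b := 4) (by norm_num)
    have hy' := Int.emod_lt_of_pos y (b := 4) (by norm_num)
    have key : (x * x - -1 * y * y) % 4 = ((x % 4) * (x % 4) + (y % 4) * (y % 4)) % 4 := by
      rw [show x * x - -1 * y * y = x * x + y * y by ring]
      simp [Int.add_emod, Int.mul_emod]
    have := Int.odd_iff.1 h
    generalize x % 4 = a at *
    generalize y % 4 = b at *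
    interval_cases a <;> interval_cases b <;> omega
  omega

lemma dvd_pow_sub_one {π α : Zi} (hπ : Prime π) (h : ¬ π ∣ α) :
    π ∣ α ^ (π.norm.natAbs - 1) - 1 := by
  have := isMaximal_span hπ
  let _ := Ideal.Quotient.field (Ideal.span {π})
  have hc := card_quotient π
  have hn : π.norm.natAbs ≠ 0 := by
    simpa using mt GaussianInt.norm_eq_zero.1 hπ.ne_zero
  have : Finite (Zi ⧸ Ideal.span {π}) := Nat.finite_of_card_ne_zero (by rwa [hc])
  let _ := Fintype.ofFinite (Zi ⧸ Ideal.span {π})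
  rw [← Ideal.mem_span_singleton, ← Ideal.Quotient.eq_zero_iff_mem, map_sub, map_pow, map_one,
    sub_eq_zero, ← hc, Nat.card_eq_fintype_card]
  apply FiniteField.pow_card_sub_one_eq_one
  rwa [Ne, Ideal.Quotient.eq_zero_iff_mem, Ideal.mem_span_singleton]

lemma exists_unit_sub {π α : Zi} (hπ : Prime π) (ho : Odd π.norm) (h : ¬ π ∣ α) :
    ∃ u : Zi, u ^ 4 = 1 ∧ π ∣ α ^ (π.norm.natAbs / 4) - u := by
  have h1 := dvd_pow_sub_one hπ h
  have h4 := natAbs_norm_mod_four ho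
  rw [show π.norm.natAbs - 1 = π.norm.natAbs / 4 * 4 by omega, pow_mul] at h1
  generalize α ^ (π.norm.natAbs / 4) = x at *
  have : x ^ 4 - 1 = (x - 1) * ((x - -1) * ((x - iZ) * (x - -iZ))) := by
    have := iZ_mul_self
    linear_combination (x ^ 2 - 1) * this
  rw [this] at h1
  rcases hπ.dvd_or_dvd h1 with h | h
  · exact ⟨1, by decide, h⟩
  rcases hπ.dvd_or_dvd h with h | h
  · exact ⟨-1, by decide, h⟩
  rcases hπ.dvd_or_dvd h with h | h
  · exact ⟨iZ, by decide, h⟩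
  · exact ⟨-iZ, by decide, h⟩

lemma toNat_norm_sub_one_div (π : Zi) (ho : Odd π.norm) :
    ((Ni π - 1) / 4).toNat = π.norm.natAbs / 4 := by
  have := natAbs_norm_mod_four ho
  have h0 := GaussianInt.norm_nonneg π
  unfold Ni
  omega

lemma quarticPrime_spec {π α : Zi} (hπ : Prime π) (ho : Odd π.norm) (h : ¬ π ∣ α) :
    quarticPrime α π ^ 4 = 1 ∧ π ∣ α ^ (π.norm.natAbs / 4) - quarticPrime α π := by
  have h1 := exists_unit_sub hπ ho h
  rw [← toNat_norm_sub_one_div π ho] at h1 ⊢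
  unfold quarticPrime
  rw [dif_pos h1]
  exact h1.choose_spec

lemma natAbs_norm_div_four_ne_zero {π : Zi} (hπ : Prime π) (ho : Odd π.norm) :
    π.norm.natAbs / 4 ≠ 0 := by
  have := natAbs_norm_mod_four ho
  intro h
  have h1 : π.norm.natAbs = 1 := by omega
  exact hπ.not_isUnit (Zsqrtd.norm_eq_one_iff.1 h1)

lemma quarticPrime_of_dvd {π α : Zi} (hπ : Prime π) (ho : Odd π.norm) (h : π ∣ α) :
    quarticPrime α π = 0 := by
  unfold quarticPrime
  rw [dif_neg]
  rintro ⟨u, hu, hd⟩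
  rw [toNat_norm_sub_one_div π ho] at hd
  have h1 := dvd_pow h (natAbs_norm_div_four_ne_zero hπ ho)
  exact hπ.not_isUnit (isUnit_of_dvd_unit ((dvd_sub_right h1).1 hd) (isUnit_of_pow_four hu))

lemma dvd_pow_sub_quarticPrime {π : Zi} (hπ : Prime π) (ho : Odd π.norm) (α : Zi) :
    π ∣ α ^ (π.norm.natAbs / 4) - quarticPrime α π := by
  by_cases h : π ∣ α
  · rw [quarticPrime_of_dvd hπ ho h, sub_zero]
    exact dvd_pow h (natAbs_norm_div_four_ne_zero hπ ho)
  · exact (quarticPrime_spec hπ ho h).2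

lemma quarticPrime_eq {π α u : Zi} (hπ : Prime π) (ho : Odd π.norm) (hu : u ^ 4 = 1)
    (h : π ∣ α ^ (π.norm.natAbs / 4) - u) : quarticPrime α π = u := by
  by_cases hd : π ∣ α
  · have h1 := dvd_pow hd (natAbs_norm_div_four_ne_zero hπ ho)
    exact absurd (isUnit_of_dvd_unit ((dvd_sub_right h1).1 h) (isUnit_of_pow_four hu))
      hπ.not_isUnit
  · obtain ⟨h1, h2⟩ := quarticPrime_spec hπ ho hd
    refine eq_of_pow_four_of_dvd_sub hπ.not_isUnit ho h1 hu ?_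
    have := dvd_sub h h2
    rwa [sub_sub_sub_cancel_left] at this

lemma quarticPrime_mul {π : Zi} (hπ : Prime π) (ho : Odd π.norm) (α β : Zi) :
    quarticPrime (α * β) π = quarticPrime α π * quarticPrime β π := by
  by_cases ha : π ∣ α
  · rw [quarticPrime_of_dvd hπ ho ha, quarticPrime_of_dvd hπ ho (ha.mul_right _), zero_mul]
  by_cases hb : π ∣ β
  · rw [quarticPrime_of_dvd hπ ho hb, quarticPrime_of_dvd hπ ho (hb.mul_left _), mul_zero]
  obtain ⟨a1, a2⟩ := quarticPrime_spec hπ ho ha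
  obtain ⟨b1, b2⟩ := quarticPrime_spec hπ ho hb
  refine quarticPrime_eq hπ ho (by rw [mul_pow, a1, b1, one_mul]) ?_
  rw [mul_pow]
  exact dvd_mul_sub_mul a2 b2

lemma quarticPrime_congr {π α β : Zi} (hπ : Prime π) (ho : Odd π.norm) (h : π ∣ α - β) :
    quarticPrime α π = quarticPrime β π := by
  by_cases hb : π ∣ β
  · rw [quarticPrime_of_dvd hπ ho hb, quarticPrime_of_dvd hπ ho ((dvd_iff_dvd_of_dvd_sub h).2 hb)]
  obtain ⟨b1, b2⟩ := quarticPrime_spec hπ ho hb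
  refine quarticPrime_eq hπ ho b1 ?_
  have := dvd_add (h.trans (sub_dvd_pow_sub_pow α β (π.norm.natAbs / 4))) b2
  rwa [sub_add_sub_cancel] at this

lemma quarticPrime_one {π : Zi} (hπ : Prime π) (ho : Odd π.norm) : quarticPrime 1 π = 1 :=
  quarticPrime_eq hπ ho (by simp) (by simp)

lemma quarticPrime_iZ {π : Zi} (hπ : Prime π) (ho : Odd π.norm) :
    quarticPrime iZ π = iZ ^ (π.norm.natAbs / 4) :=
  quarticPrime_eq hπ ho (by rw [pow_right_comm, iZ_pow_four, one_pow]) (by simp)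

lemma star_dvd_star {x y : Zi} (h : x ∣ y) : star x ∣ star y := by
  obtain ⟨z, rfl⟩ := h
  exact ⟨star z, by rw [star_mul']⟩

lemma prime_star {π : Zi} (hπ : Prime π) : Prime (star π) :=
  (MulEquiv.prime_iff (starMulAut : MulAut Zi)).2 hπ

lemma quarticPrime_star {π : Zi} (hπ : Prime π) (ho : Odd π.norm) (α : Zi) :
    quarticPrime (star α) (star π) = star (quarticPrime α π) := by
  have ho' : Odd (star π).norm := by rwa [Zsqrtd.norm_conj]
  by_cases ha : π ∣ α
  · rw [quarticPrime_of_dvd hπ ho ha, quarticPrime_of_dvd (prime_star hπ) ho' (star_dvd_star ha),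
      star_zero]
  obtain ⟨a1, a2⟩ := quarticPrime_spec hπ ho ha
  refine quarticPrime_eq (prime_star hπ) ho' (by rw [← star_pow, a1, star_one]) ?_
  rw [Zsqrtd.norm_conj, ← star_pow, ← star_sub]
  exact star_dvd_star a2

lemma quarticPrime_associated (α : Zi) {π ρ : Zi} (h : Associated π ρ) :
    quarticPrime α π = quarticPrime α ρ := by
  have hn : Ni π = Ni ρ := Zsqrtd.norm_eq_of_associated (by norm_num) h
  unfold quarticPrime
  simp only [hn, h.dvd_iff_dvd_left]

/-- The quartic residue symbol with values in `ℤ[i]`. -/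
def qs (α γ : Zi) : Zi := ((factors γ).map (quarticPrime α)).prod

lemma map_quarticPrime_eq_of_rel (α : Zi) {s t : Multiset Zi} (h : Multiset.Rel Associated s t) :
    s.map (quarticPrime α) = t.map (quarticPrime α) := by
  rw [← Multiset.rel_eq, Multiset.rel_map]
  exact h.mono fun _ _ _ _ => quarticPrime_associated α

lemma qs_mul_right (α : Zi) {γ δ : Zi} (hγ : γ ≠ 0) (hδ : δ ≠ 0) :
    qs α (γ * δ) = qs α γ * qs α δ := by
  rw [qs, map_quarticPrime_eq_of_rel α (factors_mul hγ hδ), Multiset.map_add, Multiset.prod_add]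
  rfl

lemma qs_of_isUnit (α : Zi) {γ : Zi} (h : IsUnit γ) : qs α γ = 1 := by
  simp [qs, factors_of_isUnit h]

lemma qs_prime (α : Zi) {π : Zi} (h : Prime π) : qs α π = quarticPrime α π := by
  obtain ⟨b, hb, hf⟩ := factors_eq_singleton_of_irreducible h.irreducible
  simp [qs, hf, quarticPrime_associated α hb]

lemma qs_associated (α : Zi) {γ δ : Zi} (h : Associated γ δ) : qs α γ = qs α δ := by
  rw [qs, map_quarticPrime_eq_of_rel α (factors_rel_of_associated h), qs]

lemma qs_neg_right (α γ : Zi) : qs α (-γ) = qs α γ :=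
  qs_associated α (Associated.neg_left (Associated.refl γ))

lemma odd_norm_mul {x y : Zi} : Odd (x * y).norm ↔ Odd x.norm ∧ Odd y.norm := by
  rw [Zsqrtd.norm_mul, Int.odd_mul]

lemma odd_induction {P : Zi → Prop} (hu : ∀ u, IsUnit u → P u)
    (hp : ∀ π a, Prime π → Odd π.norm → Odd a.norm → P a → P (π * a)) :
    ∀ γ : Zi, Odd γ.norm → P γ := by
  intro γ
  induction γ using induction_on_prime with
  | h₁ => simp [Zsqrtd.norm_zero]
  | h₂ u h => exact fun _ => hu u h
  | h₃ a π ha hπ ih =>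
    intro ho
    obtain ⟨h1, h2⟩ := odd_norm_mul.1 ho
    exact hp π a hπ h1 h2 (ih h2)

lemma qs_mul_left (α β : Zi) : ∀ γ : Zi, Odd γ.norm → qs (α * β) γ = qs α γ * qs β γ := by
  refine odd_induction (fun u hu => by simp [qs_of_isUnit _ hu]) fun π a hπ ho ha ih => ?_
  simp only [qs_mul_right _ hπ.ne_zero (ne_zero_of_odd_norm ha), qs_prime _ hπ, ih,
    quarticPrime_mul hπ ho]
  ring

lemma qs_congr {α β : Zi} : ∀ γ : Zi, Odd γ.norm → γ ∣ α - β → qs α γ = qs β γ := by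
  refine odd_induction (fun u hu => by simp [qs_of_isUnit _ hu]) fun π a hπ ho ha ih h => ?_
  simp only [qs_mul_right _ hπ.ne_zero (ne_zero_of_odd_norm ha), qs_prime _ hπ,
    ih (dvd_of_mul_left_dvd h), quarticPrime_congr hπ ho (dvd_of_mul_right_dvd h)]

lemma qs_one_left : ∀ γ : Zi, Odd γ.norm → qs 1 γ = 1 := by
  refine odd_induction (fun u hu => by simp [qs_of_isUnit _ hu]) fun π a hπ ho ha ih => ?_
  simp only [qs_mul_right _ hπ.ne_zero (ne_zero_of_odd_norm ha), qs_prime _ hπ,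
    ih, quarticPrime_one hπ ho, mul_one]

lemma qs_star (α : Zi) : ∀ γ : Zi, Odd γ.norm → qs (star α) (star γ) = star (qs α γ) := by
  refine odd_induction (fun u hu => by simp [qs_of_isUnit _ hu, qs_of_isUnit _ hu.star])
    fun π a hπ ho ha ih => ?_
  rw [star_mul', qs_mul_right _ hπ.ne_zero (ne_zero_of_odd_norm ha),
    qs_mul_right _ (prime_star hπ).ne_zero (star_ne_zero.2 (ne_zero_of_odd_norm ha)),
    qs_prime _ hπ, qs_prime _ (prime_star hπ), ih, quarticPrime_star hπ ho, star_mul']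

lemma qs_iZ : ∀ γ : Zi, Odd γ.norm → qs iZ γ = iZ ^ (γ.norm.natAbs / 4) := by
  refine odd_induction (fun u hu => ?_) fun π a hπ ho ha ih => ?_
  · simp [qs_of_isUnit _ hu, Zsqrtd.norm_eq_one_iff.2 hu]
  rw [qs_mul_right _ hπ.ne_zero (ne_zero_of_odd_norm ha), qs_prime _ hπ, ih,
    quarticPrime_iZ hπ ho, Zsqrtd.norm_mul, Int.natAbs_mul, ← pow_add]
  have h1 := natAbs_norm_mod_four ho
  have h2 := natAbs_norm_mod_four ha
  generalize π.norm.natAbs = m at *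
  generalize a.norm.natAbs = n at *
  have h : m * n / 4 = m / 4 + n / 4 + 4 * (m / 4 * (n / 4)) := by
    have : m * n = 4 * (m / 4 + n / 4 + 4 * (m / 4 * (n / 4))) + 1 := by
      conv_lhs => rw [← Nat.div_add_mod m 4, ← Nat.div_add_mod n 4, h1, h2]
      ring
    omega
  rw [h, pow_add _ (m / 4 + n / 4), pow_mul, iZ_pow_four, one_pow, mul_one]

lemma not_dvd_of_isCoprime {α π : Zi} (hπ : Prime π) (h : IsCoprime α π) : ¬ π ∣ α :=
  fun hd => hπ.not_isUnit (h.isUnit_of_dvd' hd dvd_rfl)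

lemma qs_pow_four {α : Zi} : ∀ γ : Zi, Odd γ.norm → IsCoprime α γ → qs α γ ^ 4 = 1 := by
  refine odd_induction (fun u hu => by simp [qs_of_isUnit _ hu]) fun π a hπ ho ha ih h => ?_
  rw [qs_mul_right _ hπ.ne_zero (ne_zero_of_odd_norm ha), qs_prime _ hπ, mul_pow,
    ih h.of_mul_right_right, mul_one]
  exact (quarticPrime_spec hπ ho (not_dvd_of_isCoprime hπ h.of_mul_right_left)).1

lemma qs_mul_star {α γ : Zi} (ho : Odd γ.norm) (h : IsCoprime α γ) :
    qs α γ * star (qs α γ) = 1 :=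
  mul_star_of_pow_four (qs_pow_four γ ho h)

lemma star_intCast (n : ℤ) : star (n : Zi) = n := by
  ext <;> simp

lemma star_natCast (n : ℕ) : star (n : Zi) = n := by
  ext <;> simp

lemma isCoprime_intCast {m n : ℤ} (h : IsCoprime m n) : IsCoprime (m : Zi) (n : Zi) :=
  h.map (Int.castRingHom Zi)

lemma exists_prime_norm_eq {q : ℕ} (hq : q.Prime) (h : q % 4 = 1) :
    ∃ ρ : Zi, Prime ρ ∧ ρ.norm = q ∧ (q : Zi) = ρ * star ρ := by
  have := Fact.mk hq
  obtain ⟨a, b, hab⟩ := Nat.Prime.sq_add_sq (p := q) (by omega)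
  have hn : (⟨a, b⟩ : Zi).norm = q := by
    rw [Zsqrtd.norm_def, ← hab]; push_cast; ring
  refine ⟨⟨a, b⟩, ?_, hn, ?_⟩
  · rw [← irreducible_iff_prime]
    refine ⟨fun hu => ?_, fun x y hxy => ?_⟩
    · rw [← Zsqrtd.norm_eq_one_iff, hn] at hu
      exact hq.ne_one hu
    · have h1 : x.norm.natAbs * y.norm.natAbs = q := by
        rw [← Int.natAbs_mul, ← Zsqrtd.norm_mul, ← hxy, hn, Int.natAbs_natCast]
      rw [← Zsqrtd.norm_eq_one_iff, ← Zsqrtd.norm_eq_one_iff]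
      have := Nat.prime_mul_iff.1 (h1 ▸ hq)
      tauto
  · rw [← Zsqrtd.norm_eq_mul_conj, hn]; simp

lemma norm_natCast_natAbs (q : ℕ) : (q : Zi).norm.natAbs = q * q := by
  rw [Zsqrtd.norm_natCast, ← Nat.cast_mul, Int.natAbs_natCast]

lemma odd_norm_natCast {q : ℕ} (hq : Odd q) : Odd (q : Zi).norm := by
  rw [Zsqrtd.norm_natCast]
  exact_mod_cast hq.mul hq

lemma odd_norm_intCast {q : ℤ} (hq : Odd q) : Odd (q : Zi).norm := by
  rw [Zsqrtd.norm_intCast]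
  exact hq.mul hq

lemma qs_intCast_prime {q : ℕ} (hq : q.Prime) (ho : Odd q) {m : ℤ} (h : IsCoprime m q) :
    qs m q = 1 := by
  have := Fact.mk hq
  have hco : IsCoprime (m : Zi) (q : Zi) := by simpa using isCoprime_intCast h
  have h2 : q % 2 = 1 := Nat.odd_iff.1 ho
  rcases (by omega : q % 4 = 1 ∨ q % 4 = 3) with h4 | h4
  · obtain ⟨ρ, hρ, hn, hqρ⟩ := exists_prime_norm_eq hq h4
    have hoρ : Odd ρ.norm := by rw [hn]; exact_mod_cast ho
    rw [hqρ] at hco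
    rw [hqρ, qs_mul_right _ hρ.ne_zero (prime_star hρ).ne_zero, ← star_intCast m,
      qs_star _ _ hoρ, star_intCast, qs_mul_star hoρ hco.of_mul_right_left]
  · have hp := GaussianInt.prime_of_nat_prime_of_mod_four_eq_three q h4
    rw [qs_prime _ hp]
    refine quarticPrime_eq hp (odd_norm_natCast ho) (by simp) ?_
    have hf : (q : ℤ) ∣ m ^ (q - 1) - 1 :=
      Int.modEq_iff_dvd.1 (Int.ModEq.pow_card_sub_one_eq_one hq h).symm
    have he : (q : Zi).norm.natAbs / 4 = (q - 1) * ((q + 1) / 4) := by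
      obtain ⟨k, rfl⟩ : ∃ k, q = 4 * k + 3 := ⟨q / 4, by omega⟩
      rw [norm_natCast_natAbs, show (4 * k + 3 + 1) / 4 = k + 1 by omega,
        show (4 * k + 3) * (4 * k + 3) = 4 * ((4 * k + 2) * (k + 1)) + 1 by ring]
      rw [show 4 * k + 3 - 1 = 4 * k + 2 by omega]
      omega
    rw [he]
    have h3 := hf.trans (sub_dvd_pow_sub_pow (m ^ (q - 1)) 1 ((q + 1) / 4))
    rw [one_pow, ← pow_mul] at h3
    simpa using (map_dvd (Int.castRingHom Zi) h3)

lemma qs_natCast_right {n : ℕ} (ho : Odd n) {m : ℤ} (h : IsCoprime m n) : qs m n = 1 := by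
  induction n using induction_on_primes with
  | zero => simp at ho
  | one => simpa using qs_of_isUnit (m : Zi) isUnit_one
  | prime_mul p a hp ih =>
    obtain ⟨h1, h2⟩ := Nat.odd_mul.1 ho
    rw [Nat.cast_mul] at h ⊢
    rw [qs_mul_right _ (ne_zero_of_odd_norm (odd_norm_natCast h1))
      (ne_zero_of_odd_norm (odd_norm_natCast h2)), qs_intCast_prime hp h1 h.of_mul_right_left,
      ih h2 h.of_mul_right_right, mul_one]

lemma qs_natCast_natAbs (α : Zi) (n : ℤ) : qs α (n.natAbs : Zi) = qs α n := by
  rcases Int.natAbs_eq n with h | h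
  · conv_rhs => rw [h, Int.cast_natCast]
  · conv_rhs => rw [h, Int.cast_neg, Int.cast_natCast, qs_neg_right]

lemma qs_intCast_intCast {m n : ℤ} (ho : Odd n) (h : IsCoprime m n) : qs m n = 1 := by
  rw [← qs_natCast_natAbs, qs_natCast_right ho.natAbs]
  rwa [Int.natCast_natAbs, IsCoprime.abs_right_iff]

lemma natCast_natAbs_norm (x : Zi) : (x.norm.natAbs : Zi) = x * star x := by
  rw [← Zsqrtd.norm_eq_mul_conj, ← GaussianInt.abs_natCast_norm x, Int.cast_natCast,
    Int.natAbs_natCast]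

/-- `r` identifies the field `K` with `ℤ[i] / π`. -/
structure IsResidue (π : Zi) {K : Type} [Field K] (r : Zi →+* K) : Prop where
  surjective : Function.Surjective r
  apply_eq_zero_iff : ∀ x, r x = 0 ↔ π ∣ x

lemma exists_isResidue {π : Zi} (hπ : Prime π) :
    ∃ (K : Type) (_ : Field K) (_ : Fintype K) (r : Zi →+* K),
      IsResidue π r ∧ Fintype.card K = π.norm.natAbs := by
  have := isMaximal_span hπ
  let _ := Ideal.Quotient.field (Ideal.span {π})
  have hn : π.norm.natAbs ≠ 0 := by
    simpa using mt GaussianInt.norm_eq_zero.1 hπ.ne_zero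
  have : Finite (Zi ⧸ Ideal.span {π}) :=
    Nat.finite_of_card_ne_zero (by rwa [card_quotient])
  let _ := Fintype.ofFinite (Zi ⧸ Ideal.span {π})
  refine ⟨Zi ⧸ Ideal.span {π}, inferInstance, inferInstance, Ideal.Quotient.mk _,
    ⟨Ideal.Quotient.mk_surjective, fun x => ?_⟩, ?_⟩
  · rw [Ideal.Quotient.eq_zero_iff_mem, Ideal.mem_span_singleton]
  · rw [← card_quotient, Nat.card_eq_fintype_card]

section ResidueField

variable {π : Zi} {K : Type} [Field K] {r : Zi →+* K}

lemma IsResidue.apply_eq_iff (hr : IsResidue π r) {x y : Zi} : r x = r y ↔ π ∣ x - y := by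
  rw [← hr.apply_eq_zero_iff, map_sub, sub_eq_zero]

/-- The quartic residue symbol modulo `π`, as a character of the residue field. -/
def quarticChar (hπ : Prime π) (ho : Odd π.norm) (hr : IsResidue π r) : MulChar K Zi where
  toFun x := quarticPrime (Function.surjInv hr.surjective x) π
  map_one' := by
    rw [← quarticPrime_one hπ ho]
    refine quarticPrime_congr hπ ho ?_
    rw [← hr.apply_eq_iff, Function.surjInv_eq hr.surjective, map_one]
  map_mul' x y := by
    rw [← quarticPrime_mul hπ ho]
    refine quarticPrime_congr hπ ho ?_
    rw [← hr.apply_eq_iff, map_mul]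
    simp only [Function.surjInv_eq hr.surjective]
  map_nonunit' x hx := by
    rw [isUnit_iff_ne_zero, not_not] at hx
    refine quarticPrime_of_dvd hπ ho ?_
    rw [← hr.apply_eq_zero_iff, Function.surjInv_eq hr.surjective, hx]

variable (hπ : Prime π) (ho : Odd π.norm) (hr : IsResidue π r)

lemma quarticChar_apply (α : Zi) : quarticChar hπ ho hr (r α) = quarticPrime α π := by
  refine quarticPrime_congr hπ ho ?_
  rw [← hr.apply_eq_iff, Function.surjInv_eq hr.surjective]

lemma residue_quarticChar (x : K) : r (quarticChar hπ ho hr x) = x ^ (π.norm.natAbs / 4) := by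
  obtain ⟨α, rfl⟩ := hr.surjective x
  rw [quarticChar_apply, ← map_pow, eq_comm, hr.apply_eq_iff]
  exact dvd_pow_sub_quarticPrime hπ ho α

lemma quarticChar_pow_four {x : K} (hx : x ≠ 0) : quarticChar hπ ho hr x ^ 4 = 1 := by
  obtain ⟨α, rfl⟩ := hr.surjective x
  rw [Ne, hr.apply_eq_zero_iff] at hx
  rw [quarticChar_apply]
  exact (quarticPrime_spec hπ ho hx).1

lemma sq_eq_of_pow_four {u : Zi} (hu : u ^ 4 = 1) : u ^ 2 = 1 ∨ u ^ 2 = -1 := by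
  rcases mem_of_isUnit (isUnit_of_pow_four hu) with rfl | rfl | rfl | rfl <;> decide

lemma star_quarticChar (x : K) :
    star (quarticChar hπ ho hr x) = (quarticChar hπ ho hr)⁻¹ x := by
  rw [MulChar.inv_apply_eq_inv]
  by_cases hx : x = 0
  · rw [hx, MulChar.map_zero, star_zero, Ring.inverse_zero]
  · have h := mul_star_of_pow_four (quarticChar_pow_four hπ ho hr hx)
    rw [Ring.inverse_of_isUnit (IsUnit.of_mul_eq_one _ h), eq_comm,
      Units.inv_eq_of_mul_eq_one_right]
    exact h

lemma ringChar_of_natCast {q : ℕ} (hq : q.Prime) (hd : π ∣ (q : Zi)) (hr : IsResidue π r) :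
    ringChar K = q :=
  CharP.ringChar_of_prime_eq_zero hq (by rwa [← map_natCast r, hr.apply_eq_zero_iff])

variable [Fintype K]

lemma exists_quarticChar_sq (hcard : Fintype.card K = π.norm.natAbs) :
    ∃ x : K, x ≠ 0 ∧ quarticChar hπ ho hr x ^ 2 = -1 := by
  have h4 := natAbs_norm_mod_four ho
  have hK : ringChar K ≠ 2 := by
    intro h
    have := (FiniteField.even_card_iff_char_two (F := K)).1 h
    omega
  obtain ⟨x, hx⟩ := FiniteField.exists_nonsquare hK
  have hx0 : x ≠ 0 := by rintro rfl; exact hx (IsSquare.zero)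
  refine ⟨x, hx0, (sq_eq_of_pow_four (quarticChar_pow_four hπ ho hr hx0)).resolve_left ?_⟩
  intro h
  apply hx
  rw [FiniteField.isSquare_iff hK hx0, hcard,
    show π.norm.natAbs / 2 = π.norm.natAbs / 4 * 2 by omega, pow_mul,
    ← residue_quarticChar hπ ho hr, ← map_pow, h, map_one]

lemma dvd_jacobiSum (hcard : Fintype.card K = π.norm.natAbs) :
    π ∣ jacobiSum (quarticChar hπ ho hr) (quarticChar hπ ho hr) := by
  have h4 := natAbs_norm_mod_four ho
  have h0 := natAbs_norm_div_four_ne_zero hπ ho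
  rw [← hr.apply_eq_zero_iff, jacobiSum, map_sum]
  simp only [map_mul, residue_quarticChar]
  set k := π.norm.natAbs / 4
  let P : Polynomial K := Polynomial.X ^ k * (1 - Polynomial.X) ^ k
  have hP : P.natDegree < 2 * k + 1 := by
    have h1 : (1 - Polynomial.X : Polynomial K).natDegree ≤ 1 :=
      (Polynomial.natDegree_sub_le _ _).trans (by simp)
    have h2 := Polynomial.natDegree_pow_le_of_le k h1
    have h3 : P.natDegree ≤ k + k * 1 :=
      Polynomial.natDegree_mul_le_of_le (by simp) h2
    omega
  have : ∀ x : K, x ^ k * (1 - x) ^ k = P.eval x := fun x => by simp [P]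
  simp only [this, Polynomial.eval_eq_sum_range' hP]
  rw [Finset.sum_comm]
  refine Finset.sum_eq_zero fun i hi => ?_
  rw [← Finset.mul_sum, FiniteField.sum_pow_lt_card_sub_one, mul_zero]
  have := Finset.mem_range.1 hi
  omega

lemma jacobiSum_mul_star (hcard : Fintype.card K = π.norm.natAbs) :
    jacobiSum (quarticChar hπ ho hr) (quarticChar hπ ho hr) *
      star (jacobiSum (quarticChar hπ ho hr) (quarticChar hπ ho hr)) = (π.norm.natAbs : Zi) := by
  set χ := quarticChar hπ ho hr with hχ
  have hstar : star (jacobiSum χ χ) = jacobiSum χ⁻¹ χ⁻¹ := by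
    simp only [jacobiSum, star_sum, star_mul', ← star_quarticChar, hχ]
  obtain ⟨x, hx0, hx⟩ := exists_quarticChar_sq hπ ho hr hcard
  have hu := isUnit_iff_ne_zero.2 hx0
  apply GaussianInt.toComplex_injective
  have hinv : χ⁻¹.ringHomComp GaussianInt.toComplex = (χ.ringHomComp GaussianInt.toComplex)⁻¹ := by
    rw [eq_inv_iff_mul_eq_one, ← MulChar.ringHomComp_mul, inv_mul_cancel, MulChar.ringHomComp_one]
  have h2 : χ.ringHomComp GaussianInt.toComplex * χ.ringHomComp GaussianInt.toComplex ≠ 1 := by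
    intro h
    have := DFunLike.congr_fun h x
    rw [MulChar.mul_apply, MulChar.one_apply hu, MulChar.ringHomComp_apply, ← map_mul, ← sq, hx]
      at this
    norm_num at this
  have h1 : χ.ringHomComp GaussianInt.toComplex ≠ 1 := by
    intro h
    rw [h, one_mul] at h2
    exact h2 rfl
  rw [map_mul, hstar, ← jacobiSum_ringHomComp, ← jacobiSum_ringHomComp, hinv,
    jacobiSum_mul_jacobiSum_inv _ h1 h1 h2, hcard, map_natCast]
  rw [ringChar.eq_zero]
  exact (CharP.ringChar_ne_zero_of_finite K).symm

lemma two_dvd_jacobiSum_sub_one (hcard : Fintype.card K = π.norm.natAbs) :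
    2 ∣ jacobiSum (quarticChar hπ ho hr) (quarticChar hπ ho hr) - 1 := by
  set χ := quarticChar hπ ho hr with hχ
  have h4 := natAbs_norm_mod_four ho
  have hK : ringChar K ≠ 2 := by
    intro h
    have := (FiniteField.even_card_iff_char_two (F := K)).1 h
    omega
  have h2 : (2 : K) ≠ 0 := Ring.two_ne_zero hK
  have hhalf : (1 : K) - 2⁻¹ = 2⁻¹ := by field_simp; norm_num
  have hodd : (2 : Zi) ∣ ∑ x ∈ Finset.univ.erase (2⁻¹ : K), χ x * χ (1 - x) := by
    rw [← Ideal.mem_span_singleton, ← Ideal.Quotient.eq_zero_iff_mem, map_sum]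
    refine Finset.sum_involution (fun x _ => 1 - x) (fun x _ => ?_) (fun x hx _ he => ?_)
      (fun x hx => ?_) fun x _ => sub_sub_cancel _ _
    · rw [sub_sub_cancel, mul_comm (χ (1 - x)), ← map_add, ← two_mul,
        Ideal.Quotient.eq_zero_iff_mem, Ideal.mem_span_singleton]
      exact dvd_mul_right _ _
    · refine Finset.ne_of_mem_erase hx ?_
      field_simp
      linear_combination -he
    · refine Finset.mem_erase.2 ⟨fun he => Finset.ne_of_mem_erase hx ?_, Finset.mem_univ _⟩
      rw [← hhalf, ← he, sub_sub_cancel]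
  rw [jacobiSum, ← Finset.sum_erase_add _ _ (Finset.mem_univ (2⁻¹ : K)), hhalf, add_sub_assoc]
  refine dvd_add hodd ?_
  rw [← sq]
  rcases sq_eq_of_pow_four (quarticChar_pow_four hπ ho hr (inv_ne_zero h2)) with h | h <;>
    rw [hχ, h]
  · simp
  · exact ⟨-1, by norm_num⟩

lemma jacobiSum_sq (hcard : Fintype.card K = π.norm.natAbs) (him : Even π.im) :
    jacobiSum (quarticChar hπ ho hr) (quarticChar hπ ho hr) ^ 2 = π ^ 2 := by
  obtain ⟨t, ht⟩ := dvd_jacobiSum hπ ho hr hcard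
  have hN := jacobiSum_mul_star hπ ho hr hcard
  obtain ⟨s, hs⟩ := two_dvd_jacobiSum_sub_one hπ ho hr hcard
  rw [ht] at hN hs ⊢
  have hn := natCast_natAbs_norm π
  have ht1 : t * star t = 1 := by
    have h0 : π * star π ≠ 0 := mul_ne_zero hπ.ne_zero (star_ne_zero.2 hπ.ne_zero)
    apply mul_left_cancel₀ h0
    rw [star_mul', hn] at hN
    linear_combination hN
  have hre : (π * t).re = 2 * s.re + 1 := by
    have := congrArg Zsqrtd.re hs
    simp at this
    simp
    linarith
  have hsq : t ^ 2 = 1 := by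
    obtain ⟨k, hk⟩ := him
    rcases mem_of_isUnit (IsUnit.of_mul_eq_one _ ht1) with rfl | rfl | rfl | rfl
    · norm_num
    · norm_num
    · simp [iZ] at hre
      omega
    · simp [iZ] at hre
      omega
  rw [mul_pow, hsq, mul_one]

end ResidueField

section GaussSum

variable {π : Zi} {K : Type} [Field K] {r : Zi →+* K} {F : Type} [Field F]
  (hπ : Prime π) (ho : Odd π.norm) (hr : IsResidue π r) (φ : Zi →+* F) {ψ : AddChar K F}

lemma ringHomComp_quarticChar_pow {m n : ℕ} (h : m % 4 = n % 4) :
    ((quarticChar hπ ho hr).ringHomComp φ) ^ m = ((quarticChar hπ ho hr).ringHomComp φ) ^ n := by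
  ext a
  simp only [MulChar.pow_apply_coe, MulChar.ringHomComp_apply]
  rw [← map_pow φ, ← map_pow φ]
  have h4 := quarticChar_pow_four hπ ho hr a.ne_zero
  rw [← Nat.div_add_mod m 4, ← Nat.div_add_mod n 4, h, pow_add, pow_add, pow_mul, pow_mul, h4,
    one_pow, one_pow]

variable [Fintype K]

lemma gaussSum_quarticChar_pow_four (hcard : Fintype.card K = π.norm.natAbs) (him : Even π.im)
    (h2 : ringChar F ≠ 2) (hψ : ψ.IsPrimitive) :
    gaussSum ((quarticChar hπ ho hr).ringHomComp φ) ψ ^ 4 = φ (π ^ 3 * star π) := by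
  set χ := (quarticChar hπ ho hr).ringHomComp φ with hχ
  obtain ⟨x, hx0, hx⟩ := exists_quarticChar_sq hπ ho hr hcard
  have hne : χ * χ ≠ 1 := by
    intro h
    have := DFunLike.congr_fun h x
    rw [MulChar.mul_apply, MulChar.one_apply (isUnit_iff_ne_zero.2 hx0), hχ,
      MulChar.ringHomComp_apply, ← map_mul, ← sq, hx, map_neg, map_one] at this
    exact Ring.neg_one_ne_one_of_char_ne_two h2 this
  have hquad : (χ * χ).IsQuadratic := by
    intro y
    by_cases hy : y = 0
    · left
      rw [hy, MulChar.map_zero]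
    · right
      rw [MulChar.mul_apply, hχ, MulChar.ringHomComp_apply, ← map_mul, ← sq]
      rcases sq_eq_of_pow_four (quarticChar_pow_four hπ ho hr hy) with h | h <;> rw [h] <;> simp
  have hneg : (χ * χ) (-1) = 1 := by
    rw [MulChar.mul_apply, ← map_mul, neg_one_mul, neg_neg, MulChar.map_one]
  have hs := gaussSum_sq hne hquad hψ
  have hj := jacobiSum_mul_nontrivial hne ψ
  have hJ := congrArg φ (jacobiSum_sq hπ ho hr hcard him)
  have hn : (Fintype.card K : F) = φ (π * star π) := by
    rw [hcard, ← natCast_natAbs_norm, map_natCast]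
  rw [hneg, one_mul, hn] at hs
  rw [hχ, jacobiSum_ringHomComp, ← hχ] at hj
  rw [map_pow, map_pow] at hJ
  calc gaussSum χ ψ ^ 4 = (gaussSum χ ψ * gaussSum χ ψ) ^ 2 := by ring
    _ = φ (π ^ 3 * star π) := by
      rw [← hj, mul_pow, hs, hJ]
      simp only [map_mul, map_pow]
      ring

lemma gaussSum_quarticChar_pow {q : ℕ} [Fact q.Prime] [CharP F q] (hq : IsUnit (q : K)) {n : ℕ}
    (h : q % 4 = n % 4) :
    φ (quarticChar hπ ho hr q ^ n) * gaussSum ((quarticChar hπ ho hr).ringHomComp φ) ψ ^ q =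
      gaussSum (((quarticChar hπ ho hr).ringHomComp φ) ^ n) ψ := by
  rw [gaussSum_frob, AddChar.pow_mulShift,
    ringHomComp_quarticChar_pow hπ ho hr φ h,
    ← gaussSum_mulShift _ ψ hq.unit, MulChar.pow_apply_coe, hq.unit_spec,
    MulChar.ringHomComp_apply, map_pow]

lemma gaussSum_quarticChar_mul (hcard : Fintype.card K = π.norm.natAbs) (h2 : ringChar F ≠ 2)
    (hψ : ψ.IsPrimitive) :
    gaussSum ((quarticChar hπ ho hr).ringHomComp φ) ψ *
        gaussSum (((quarticChar hπ ho hr).ringHomComp φ) ^ 3) ψ =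
      φ (quarticChar hπ ho hr (-1)) * π.norm.natAbs := by
  set χ := (quarticChar hπ ho hr).ringHomComp φ with hχ
  have h4 : χ ^ 4 = 1 := by
    ext a
    rw [MulChar.pow_apply_coe, hχ, MulChar.ringHomComp_apply, ← map_pow,
      quarticChar_pow_four hπ ho hr a.ne_zero, map_one, MulChar.one_apply_coe]
  have hinv : χ ^ 3 = χ⁻¹ := by
    rw [eq_inv_iff_mul_eq_one, ← pow_succ, h4]
  have hne : χ ≠ 1 := by
    intro h
    obtain ⟨x, hx0, hx⟩ := exists_quarticChar_sq hπ ho hr hcard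
    have := DFunLike.congr_fun h x
    rw [MulChar.one_apply (isUnit_iff_ne_zero.2 hx0), hχ, MulChar.ringHomComp_apply] at this
    have h' := congrArg φ hx
    rw [map_pow, this, one_pow, map_neg, map_one] at h'
    exact Ring.neg_one_ne_one_of_char_ne_two h2 h'.symm
  rw [hinv, ← mul_gaussSum_inv_eq_gaussSum χ⁻¹ ψ, mul_left_comm,
    gaussSum_mul_gaussSum_eq_card hne hψ, MulChar.inv_apply', inv_neg_one, hcard, hχ,
    MulChar.ringHomComp_apply]

end GaussSum

lemma exists_gaussSum {π ρ : Zi} {K : Type} [Field K] [Fintype K] {r : Zi →+* K} (hπ : Prime π)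
    (ho : Odd π.norm) (hr : IsResidue π r) (hcard : Fintype.card K = π.norm.natAbs)
    (him : Even π.im) (hρ : Prime ρ) {q : ℕ} (hq : q.Prime) (hqo : Odd q) (hρq : ρ ∣ (q : Zi))
    (hπq : ¬ π ∣ (q : Zi)) :
    ∃ (F : Type) (_ : Field F) (φ : Zi →+* F) (g : F), (∀ x, φ x = 0 ↔ ρ ∣ x) ∧
      g ^ 4 = φ (π ^ 3 * star π) ∧
      (q % 4 = 1 → φ (quarticPrime q π) * g ^ q = g) ∧
      (q % 4 = 3 → φ (quarticPrime q π ^ 3) * g ^ (q + 1) =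
        φ (quarticPrime (-1) π * (π * star π))) := by
  obtain ⟨L, _, _, s, hs, -⟩ := exists_isResidue hρ
  have hL : ringChar L = q := ringChar_of_natCast hq hρq hs
  have hqK : (q : K) ≠ 0 := by rwa [← map_natCast r, Ne, hr.apply_eq_zero_iff]
  have hne : ringChar L ≠ ringChar K := by
    rw [hL]
    intro h
    exact hqK (h ▸ ringChar.Nat.cast_ringChar)
  let ψ := AddChar.FiniteField.primitiveChar K L hne
  have := Fact.mk hq
  have : CharP L q := hL ▸ ringChar.charP L
  have : CharP (CyclotomicField ψ.n L) q := charP_of_injective_algebraMap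
    (algebraMap L (CyclotomicField ψ.n L)).injective q
  have h2 : ringChar (CyclotomicField ψ.n L) ≠ 2 := by
    rw [ringChar.eq (CyclotomicField ψ.n L) q]
    rintro rfl
    exact absurd hqo (by decide)
  let φ := (algebraMap L (CyclotomicField ψ.n L)).comp s
  have hχ (α : Zi) : quarticPrime α π = quarticChar hπ ho hr (r α) :=
    (quarticChar_apply hπ ho hr α).symm
  refine ⟨_, inferInstance, φ, gaussSum ((quarticChar hπ ho hr).ringHomComp φ) ψ.char,
    fun x => ?_, gaussSum_quarticChar_pow_four hπ ho hr φ hcard him h2 ψ.prim, fun h => ?_,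
    fun h => ?_⟩
  · rw [← hs.apply_eq_zero_iff, RingHom.comp_apply, map_eq_zero]
  · have := gaussSum_quarticChar_pow hπ ho hr φ (ψ := ψ.char) hqK.isUnit (n := 1) h
    rwa [pow_one, pow_one, ← map_natCast r, ← hχ] at this
  · have h3 := gaussSum_quarticChar_pow hπ ho hr φ (ψ := ψ.char) hqK.isUnit (n := 3) h
    have h4 := gaussSum_quarticChar_mul hπ ho hr φ hcard h2 ψ.prim
    rw [hχ, hχ, map_natCast, map_neg, map_one, map_mul, ← natCast_natAbs_norm,
      map_natCast φ, ← h4, ← h3]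
    ring
lemma quarticPrime_pow_four {α π : Zi} (hπ : Prime π) (ho : Odd π.norm) (h : ¬ π ∣ α) :
    quarticPrime α π ^ 4 = 1 :=
  (quarticPrime_spec hπ ho h).1

lemma odd_of_mod_four_eq_one {q : ℕ} (h : q % 4 = 1) : Odd q :=
  Nat.odd_iff.2 (by omega)

lemma odd_of_mod_four_eq_three {q : ℕ} (h : q % 4 = 3) : Odd q :=
  Nat.odd_iff.2 (by omega)

lemma not_dvd_of_dvd_natCast {π ρ : Zi} (hπ : Prime π) (hρ : Prime ρ) {q : ℕ}
    (hρq : ρ ∣ (q : Zi)) (h : ¬ π ∣ (q : Zi)) : ¬ ρ ∣ π := fun hd =>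
  h (((hρ.associated_of_dvd hπ hd).symm.dvd).trans hρq)

lemma not_dvd_star_of_dvd_natCast {π ρ : Zi} (hπ : Prime π) (hρ : Prime ρ) {q : ℕ}
    (hρq : ρ ∣ (q : Zi)) (h : ¬ π ∣ (q : Zi)) : ¬ ρ ∣ star π := by
  refine not_dvd_of_dvd_natCast (prime_star hπ) hρ hρq fun hd => h ?_
  simpa [star_natCast] using star_dvd_star hd

lemma quarticPrime_natCast_mul {π ρ : Zi} (hπ : Prime π) (ho : Odd π.norm) (him : Even π.im)
    (hρ : Prime ρ) {q : ℕ} (hq : q.Prime) (hq4 : q % 4 = 1) (hρn : ρ.norm = q)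
    (hρq : ρ ∣ (q : Zi)) (hπq : ¬ π ∣ (q : Zi)) :
    quarticPrime q π * quarticPrime (π ^ 3 * star π) ρ = 1 := by
  obtain ⟨K, _, _, r, hr, hcard⟩ := exists_isResidue hπ
  obtain ⟨F, _, φ, g, hφ, hg4, hg, -⟩ := exists_gaussSum hπ ho hr hcard him hρ hq
    (odd_of_mod_four_eq_one hq4) hρq hπq
  have hρo : Odd ρ.norm := hρn ▸ by exact_mod_cast odd_of_mod_four_eq_one hq4
  have hA : ¬ ρ ∣ π ^ 3 * star π := fun hd => (hρ.dvd_or_dvd hd).elim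
    (fun h => not_dvd_of_dvd_natCast hπ hρ hρq hπq (hρ.dvd_of_dvd_pow h))
    (not_dvd_star_of_dvd_natCast hπ hρ hρq hπq)
  have hg0 : g ≠ 0 := by
    rintro rfl
    exact hA ((hφ _).1 (by rw [← hg4, zero_pow four_ne_zero]))
  have h1 : φ (quarticPrime q π * (π ^ 3 * star π) ^ (q / 4) - 1) = 0 := by
    have := hg hq4
    rw [map_sub, map_mul, map_pow φ _ (q / 4), ← hg4, ← pow_mul, map_one, sub_eq_zero]
    apply mul_right_cancel₀ hg0
    rw [one_mul, mul_assoc, ← pow_succ, show 4 * (q / 4) + 1 = q by omega, this]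
  rw [hφ] at h1
  have h2 := dvd_pow_sub_quarticPrime hρ hρo (π ^ 3 * star π)
  rw [hρn, Int.natAbs_natCast] at h2
  refine eq_of_pow_four_of_dvd_sub hρ.not_isUnit hρo ?_ (one_pow 4) ?_
  · rw [mul_pow, quarticPrime_pow_four hπ ho hπq, quarticPrime_pow_four hρ hρo hA, one_mul]
  · convert h1.sub (h2.mul_left (quarticPrime q π)) using 1
    ring

lemma qs_natCast_of_mod_four_eq_one {π : Zi} (hπ : Prime π) (ho : Odd π.norm) (him : Even π.im)
    {q : ℕ} (hq : q.Prime) (hq4 : q % 4 = 1) (hπq : ¬ π ∣ (q : Zi)) :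
    qs q π = qs π q := by
  obtain ⟨ρ, hρ, hρn, hqρ⟩ := exists_prime_norm_eq hq hq4
  have hρq : ρ ∣ (q : Zi) := hqρ ▸ dvd_mul_right _ _
  have hρq' : star ρ ∣ (q : Zi) := hqρ ▸ dvd_mul_left _ _
  have hρo : Odd ρ.norm := hρn ▸ by exact_mod_cast odd_of_mod_four_eq_one hq4
  have hρo' : Odd (star ρ).norm := by rwa [Zsqrtd.norm_conj]
  have h := quarticPrime_natCast_mul hπ ho him hρ hq hq4 hρn hρq hπq
  have hv := quarticPrime_pow_four hρ hρo (not_dvd_of_dvd_natCast hπ hρ hρq hπq)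
  have hw := mul_star_of_pow_four (quarticPrime_pow_four (prime_star hρ) hρo'
    (not_dvd_of_dvd_natCast hπ (prime_star hρ) hρq' hπq))
  have hs := quarticPrime_star (prime_star hρ) hρo' π
  rw [star_star] at hs
  rw [hqρ, qs_mul_right _ hρ.ne_zero (prime_star hρ).ne_zero, qs_prime _ hρ,
    qs_prime _ (prime_star hρ), qs_prime _ hπ, ← hqρ]
  rw [quarticPrime_mul hρ hρo, pow_succ, pow_two, quarticPrime_mul hρ hρo,
    quarticPrime_mul hρ hρo, hs] at h
  linear_combination (-quarticPrime q π * quarticPrime π ρ ^ 4) * hw - quarticPrime q π * hv +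
    quarticPrime π ρ * quarticPrime π (star ρ) * h

lemma prime_natCast {q : ℕ} (hq : q.Prime) (h : q % 4 = 3) : Prime (q : Zi) :=
  have := Fact.mk hq
  (GaussianInt.prime_iff_mod_four_eq_three_of_nat_prime q).2 h

lemma natCast_dvd_pow_sub_star {q : ℕ} (hq : q.Prime) (h : q % 4 = 3) (x : Zi) :
    (q : Zi) ∣ x ^ q - star x := by
  have := Fact.mk hq
  have hint (n : ℤ) : (q : Zi) ∣ (n : Zi) ^ q - n := by
    have : (q : ℤ) ∣ n ^ q - n := by
      rw [← ZMod.intCast_zmod_eq_zero_iff_dvd]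
      simp
    obtain ⟨k, hk⟩ := this
    exact ⟨k, by exact_mod_cast congrArg (Int.cast : ℤ → Zi) hk⟩
  obtain ⟨t, ht⟩ := exists_add_pow_prime_eq hq (x.re : Zi) (iZ * x.im)
  have hi : iZ ^ q = -iZ := by
    rw [← Nat.div_add_mod q 4, h, pow_add, pow_mul, iZ_pow_four, one_pow]
    decide
  have hx : x = x.re + iZ * x.im := by ext <;> simp [iZ]
  have hx' : star x = x.re - iZ * x.im := by ext <;> simp [iZ]
  obtain ⟨k, hk⟩ := hint x.re
  obtain ⟨l, hl⟩ := hint x.im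
  rw [hx']
  conv => enter [2, 1]; rw [hx, ht, mul_pow, hi]
  exact ⟨k - iZ * l + x.re * (iZ * x.im) * t, by linear_combination hk - iZ * hl⟩

lemma qs_natCast_of_mod_four_eq_three {π : Zi} (hπ : Prime π) (ho : Odd π.norm)
    (him : Even π.im) {q : ℕ} (hq : q.Prime) (hq4 : q % 4 = 3) (hπq : ¬ π ∣ (q : Zi)) :
    qs (-q) π = qs π q := by
  have hqo := odd_of_mod_four_eq_three hq4
  have hρ := prime_natCast hq hq4
  have hρo := odd_norm_natCast hqo
  have hqπ := not_dvd_of_dvd_natCast hπ hρ dvd_rfl hπq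
  obtain ⟨K, _, _, r, hr, hcard⟩ := exists_isResidue hπ
  obtain ⟨F, _, φ, g, hφ, hg4, -, hg⟩ := exists_gaussSum hπ ho hr hcard him hρ hq hqo dvd_rfl hπq
  have hneg : ¬ π ∣ -1 := fun h => hπ.not_isUnit (isUnit_of_dvd_unit h isUnit_one.neg)
  have hfrob : φ (star π) = φ π ^ q := by
    rw [← map_pow, ← sub_eq_zero, ← map_sub, hφ, dvd_sub_comm]
    exact natCast_dvd_pow_sub_star hq hq4 π
  have hres : φ (quarticPrime π q) = φ π ^ (q * q / 4) := by
    rw [← map_pow, ← sub_eq_zero, ← map_sub, hφ, dvd_sub_comm, ← norm_natCast_natAbs q]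
    exact dvd_pow_sub_quarticPrime hρ hρo π
  have h0 : φ π ≠ 0 := by rwa [Ne, hφ]
  have h1 : φ (quarticPrime q π ^ 3 * quarticPrime π q - quarticPrime (-1) π) = 0 := by
    have h := hg hq4
    obtain ⟨k, rfl⟩ : ∃ k, q = 4 * k + 3 := ⟨q / 4, by omega⟩
    rw [show 4 * k + 3 + 1 = 4 * (k + 1) by ring, pow_mul, hg4] at h
    have he : (4 * k + 3) * (4 * k + 3) / 4 = (4 * k + 2) * (k + 1) := by
      rw [show (4 * k + 3) * (4 * k + 3) = 1 + 4 * ((4 * k + 2) * (k + 1)) by ring]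
      omega
    rw [map_sub, map_mul, hres, he, sub_eq_zero]
    apply mul_right_cancel₀ (pow_ne_zero (4 * k + 4) h0)
    simp only [map_mul, map_pow, hfrob] at h ⊢
    linear_combination h
  have h2 : quarticPrime q π ^ 3 * quarticPrime π q = quarticPrime (-1) π := by
    rw [hφ] at h1
    refine eq_of_pow_four_of_dvd_sub hρ.not_isUnit hρo ?_ (quarticPrime_pow_four hπ ho hneg) h1
    rw [mul_pow, quarticPrime_pow_four hρ hρo hqπ, pow_right_comm,
      quarticPrime_pow_four hπ ho hπq, one_pow, one_mul]
  rw [qs_prime _ hπ, qs_prime _ hρ, ← neg_one_mul, quarticPrime_mul hπ ho, ← h2]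
  linear_combination quarticPrime π q * quarticPrime_pow_four hπ ho hπq
lemma isCoprime_of_intCast {m n : ℤ} (h : IsCoprime (m : Zi) (n : Zi)) : IsCoprime m n := by
  obtain ⟨u, v, huv⟩ := h
  refine ⟨u.re, v.re, ?_⟩
  simpa using congrArg Zsqrtd.re huv

lemma exists_isUnit_even_im {x : Zi} (h : Odd x.norm) : ∃ u, IsUnit u ∧ Even (u * x).im := by
  rw [Zsqrtd.norm_def] at h
  rcases Int.even_or_odd x.im with hi | hi
  · exact ⟨1, isUnit_one, by rwa [one_mul]⟩
  · refine ⟨iZ, isUnit_of_pow_four iZ_pow_four, ?_⟩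
    have : Even x.re := by
      by_contra hr
      rw [Int.not_even_iff_odd] at hr
      have := (hr.mul hr).add_odd (hi.mul hi)
      rw [← Int.not_even_iff_odd] at h
      apply h
      rwa [show x.re * x.re - -1 * x.im * x.im = x.re * x.re + x.im * x.im by ring]
    simpa [iZ] using this

lemma even_im_of_even_im_mul {x y : Zi} (h : Odd x.norm) (hx : Even x.im)
    (hxy : Even (x * y).im) : Even y.im := by
  rw [Zsqrtd.norm_def] at h
  rw [Zsqrtd.im_mul] at hxy
  have hr : Odd x.re := by
    by_contra hr
    rw [Int.not_odd_iff_even] at hr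
    rw [← Int.not_even_iff_odd] at h
    exact h ((hr.mul_right _).sub (hx.mul_left _))
  have := (Int.even_add.1 hxy).2 (hx.mul_right _)
  exact (Int.even_mul.1 this).resolve_left (by rwa [Int.not_even_iff_odd])

lemma isUnit_eq_of_even_im {u : Zi} (hu : IsUnit u) (h : Even u.im) :
    u = ((1 : ℤ) : Zi) ∨ u = ((-1 : ℤ) : Zi) := by
  rcases mem_of_isUnit hu with rfl | rfl | rfl | rfl
  · simp
  · simp
  · exact absurd h (by decide)
  · exact absurd h (by decide)

/-- For odd `n` this is the one of `n` and `-n` which is `1` modulo `4`. -/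
def signed (n : ℤ) : ℤ := ZMod.χ₄ n * n

lemma signed_mul (m n : ℤ) : signed (m * n) = signed m * signed n := by
  simp only [signed, Int.cast_mul, map_mul]
  ring

lemma qs_signed_prime {π : Zi} (hπ : Prime π) (ho : Odd π.norm) (him : Even π.im) {n : ℕ}
    (hn : Odd n) (hco : IsCoprime π (n : Zi)) : qs (signed n) π = qs π n := by
  induction n using induction_on_primes with
  | zero => simp at hn
  | one => simpa [signed, qs_of_isUnit] using qs_one_left π ho
  | prime_mul q a hq ih =>
    rw [Nat.odd_mul] at hn
    rw [Nat.cast_mul] at hco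
    have hπq : ¬ π ∣ (q : Zi) := not_dvd_of_isCoprime hπ hco.of_mul_right_left.symm
    have hq' : qs (signed q) π = qs π q := by
      have h2 := Nat.odd_iff.1 hn.1
      rcases (by omega : q % 4 = 1 ∨ q % 4 = 3) with h | h
      · rw [← qs_natCast_of_mod_four_eq_one hπ ho him hq h hπq, signed, Int.cast_natCast,
          ZMod.χ₄_nat_one_mod_four h]
        simp
      · rw [← qs_natCast_of_mod_four_eq_three hπ ho him hq h hπq, signed, Int.cast_natCast,
          ZMod.χ₄_nat_three_mod_four h]
        simp
    rw [Nat.cast_mul, signed_mul, Int.cast_mul, qs_mul_left _ _ _ ho, hq',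
      ih hn.2 hco.of_mul_right_right, Nat.cast_mul,
      qs_mul_right _ (ne_zero_of_odd_norm (odd_norm_natCast hn.1))
        (ne_zero_of_odd_norm (odd_norm_natCast hn.2))]

lemma qs_signed_of_isUnit_mul {n : ℕ} (hn : Odd n) : ∀ α : Zi, Odd α.norm →
    IsCoprime α (n : Zi) → ∀ u, IsUnit u → Even (u * α).im → qs (signed n) α = qs (u * α) n := by
  have hno := odd_norm_natCast hn
  refine odd_induction (fun v hv _ u hu he => ?_) fun π a hπ ho ha ih hco u hu he => ?_
  · rw [qs_of_isUnit _ hv]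
    have h1 : IsCoprime (1 : ℤ) n := isCoprime_one_left
    rcases isUnit_eq_of_even_im (hu.mul hv) he with h | h <;> rw [h]
    · exact (qs_natCast_right hn h1).symm
    · exact (qs_natCast_right hn h1.neg_left).symm
  · obtain ⟨v, hv, hve⟩ := exists_isUnit_even_im ho
    obtain ⟨v, rfl⟩ := hv
    have hvo : Odd (v * π).norm := odd_norm_mul.2 ⟨?_, ho⟩
    · have hsplit : u * (π * a) = v * π * (u * ↑v⁻¹ * a) := by
        linear_combination (-u * π * a) * v.mul_inv
      have hvπ : Associated (v * π) π := ⟨v⁻¹, by rw [mul_right_comm, v.mul_inv, one_mul]⟩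
      rw [hsplit] at he ⊢
      rw [qs_mul_right _ hπ.ne_zero (ne_zero_of_odd_norm ha), qs_mul_left _ _ _ hno,
        ← ih hco.of_mul_left_right _ (hu.mul v⁻¹.isUnit) (even_im_of_even_im_mul hvo hve he),
        ← qs_signed_prime (hvπ.symm.prime hπ) hvo hve hn
          ((isCoprime_mul_unit_left_left v.isUnit _ _).2 hco.of_mul_left_left),
        qs_associated _ hvπ]
    · rw [(Zsqrtd.norm_eq_one_iff' (by norm_num) (v : Zi)).2 v.isUnit]
      exact odd_one

lemma signed_neg (n : ℤ) : signed (-n) = signed n := by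
  rw [signed, signed, ← neg_one_mul, Int.cast_mul, map_mul]
  simp [show ZMod.χ₄ (-1) = -1 by decide]

/-- Reciprocity between a rational integer and a Gaussian integer. -/
lemma qs_signed {n : ℤ} (hn : Odd n) {α : Zi} (ho : Odd α.norm) (him : Even α.im)
    (hco : IsCoprime α (n : Zi)) : qs (signed n) α = qs α n := by
  have hs : signed n = signed n.natAbs := by
    rcases Int.natAbs_eq n with h | h
    · rw [← h]
    · rw [h, signed_neg, Int.natAbs_neg, Int.natAbs_natCast]
  have hco' : IsCoprime α (n.natAbs : Zi) := by
    rcases Int.natAbs_eq n with h | h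
    · rwa [h, Int.cast_natCast] at hco
    · rwa [h, Int.cast_neg, Int.cast_natCast, IsCoprime.neg_right_iff] at hco
  rw [hs, qs_signed_of_isUnit_mul hn.natAbs α ho hco' 1 isUnit_one (by rwa [one_mul]), one_mul,
    qs_natCast_natAbs]
/-- `γ ≡ 1` modulo `(1 + i) ^ 3`. -/
def IsPrimary (γ : Zi) : Prop := Even γ.im ∧ (4 : ℤ) ∣ γ.re + γ.im - 1

lemma IsPrimary.odd_re {γ : Zi} (h : IsPrimary γ) : Odd γ.re := by
  obtain ⟨⟨k, hk⟩, l, hl⟩ := h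
  exact ⟨2 * l - k, by omega⟩

lemma IsPrimary.odd_norm {γ : Zi} (h : IsPrimary γ) : Odd γ.norm := by
  rw [Zsqrtd.norm_def]
  exact (h.odd_re.mul h.odd_re).sub_even (h.1.mul_left _)

lemma IsPrimary.star {γ : Zi} (h : IsPrimary γ) : IsPrimary (star γ) := by
  obtain ⟨⟨k, hk⟩, l, hl⟩ := h
  exact ⟨⟨-k, by simp [hk]⟩, l - k, by simp; omega⟩

lemma IsPrimary.natAbs_norm_div_four {γ : Zi} (h : IsPrimary γ) :
    Even (γ.norm.natAbs / 4) ↔ 4 ∣ γ.im := by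
  obtain ⟨⟨k, hk⟩, l, hl⟩ := h
  obtain ⟨a, b⟩ := γ
  simp only [Zsqrtd.norm_def] at *
  have ha : a = 4 * l + 1 - 2 * k := by omega
  obtain ⟨e, he⟩ := Int.even_mul_succ_self (2 * l - k)
  have hN : a * a - -1 * b * b = 4 * (2 * e + k * k) + 1 := by
    rw [hk, ha]
    linear_combination 4 * he
  rw [hN]
  have h0 := mul_self_nonneg k
  have h1 : 0 ≤ e := by
    rcases le_or_gt 0 (2 * l - k) with h | h
    · nlinarith
    · nlinarith
  have h2 : (((4 * (2 * e + k * k) + 1).natAbs / 4 : ℕ) : ℤ) = 2 * e + k * k := by omega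
  rw [← Int.even_coe_nat, h2, Int.even_add, Int.even_mul, Int.even_mul]
  simp only [even_two, true_or, true_iff, or_self]
  rw [Int.even_iff]
  omega

lemma IsPrimary.χ₄_re {γ : Zi} (h : IsPrimary γ) :
    ZMod.χ₄ γ.re = (-1) ^ (γ.norm.natAbs / 4) := by
  have hi := h.natAbs_norm_div_four
  obtain ⟨⟨k, hk⟩, l, hl⟩ := h
  by_cases h4 : 4 ∣ γ.im
  · rw [(hi.2 h4).neg_one_pow, ZMod.χ₄_int_one_mod_four]
    omega
  · rw [(Nat.not_even_iff_odd.1 (mt hi.1 h4)).neg_one_pow, ZMod.χ₄_int_three_mod_four]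
    omega

lemma IsPrimary.qs_neg_one {γ : Zi} (h : IsPrimary γ) : qs (-1) γ = (ZMod.χ₄ γ.re : ℤ) := by
  have h2 : (-1 : Zi) = iZ * iZ := iZ_mul_self.symm
  rw [h2, qs_mul_left _ _ _ h.odd_norm, qs_iZ _ h.odd_norm, ← mul_pow, iZ_mul_self, h.χ₄_re]
  push_cast
  rfl

lemma χ₄_eq_one_or {n : ℤ} (hn : Odd n) : ZMod.χ₄ n = 1 ∨ ZMod.χ₄ n = -1 := by
  have := Int.odd_iff.1 hn
  rcases (by omega : n % 4 = 1 ∨ n % 4 = 3) with h | h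
  · exact Or.inl (ZMod.χ₄_int_one_mod_four h)
  · exact Or.inr (ZMod.χ₄_int_three_mod_four h)

lemma χ₈_mul_self {n : ℤ} (hn : Odd n) : ZMod.χ₈ n * ZMod.χ₈ n = 1 := by
  have := Int.odd_iff.1 hn
  rw [ZMod.χ₈_int_eq_if_mod_eight]
  split_ifs
  · omega
  · rfl
  · rfl

lemma qs_iZ_intCast {n : ℤ} (hn : Odd n) : qs iZ n = (ZMod.χ₈ n : ℤ) := by
  rw [qs_iZ _ (odd_norm_intCast hn), Zsqrtd.norm_intCast, ZMod.χ₈_int_eq_if_mod_eight]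
  obtain ⟨k, rfl⟩ := hn
  obtain ⟨e, he⟩ := Int.even_mul_succ_self k
  have h0 : 0 ≤ e := by
    rcases le_or_gt 0 k with h | h <;> nlinarith
  obtain ⟨e, rfl⟩ := Int.eq_ofNat_of_zero_le h0
  have hN : ((2 * k + 1) * (2 * k + 1)).natAbs / 4 = 2 * e := by
    rw [show (2 * k + 1) * (2 * k + 1) = 8 * e + 1 by linear_combination 4 * he]
    omega
  rw [hN, pow_mul, pow_two, iZ_mul_self, if_neg (by omega)]
  obtain ⟨t, r, hr, rfl⟩ : ∃ t r : ℤ, (r = 0 ∨ r = 1 ∨ r = 2 ∨ r = 3) ∧ k = 4 * t + r :=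
    ⟨k / 4, k % 4, by omega, by omega⟩
  have he' : (e : ℤ) = 8 * (t * t) + (4 * r + 2) * t + (r * r + r) / 2 := by
    have : (2 * e : ℤ) = 2 * (8 * (t * t) + (4 * r + 2) * t) + (r * r + r) := by
      linear_combination -he
    omega
  rcases hr with rfl | rfl | rfl | rfl
  · rw [if_pos (by omega), Even.neg_one_pow, Int.cast_one]
    rw [← Int.even_coe_nat, Int.even_iff]
    omega
  · rw [if_neg (by omega), Odd.neg_one_pow, Int.cast_neg, Int.cast_one]
    rw [← Int.odd_coe_nat, Int.odd_iff]
    omega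
  · rw [if_neg (by omega), Odd.neg_one_pow, Int.cast_neg, Int.cast_one]
    rw [← Int.odd_coe_nat, Int.odd_iff]
    omega
  · rw [if_pos (by omega), Even.neg_one_pow, Int.cast_one]
    rw [← Int.even_coe_nat, Int.even_iff]
    omega

lemma isCoprime_of_dvd_sub {x y γ : Zi} (h : IsCoprime x γ) (hd : γ ∣ y - x) : IsCoprime y γ := by
  obtain ⟨t, ht⟩ := hd
  rw [show y = x + γ * t by linear_combination ht]
  exact h.add_mul_left_left t

lemma isCoprime_intCast_re {γ : Zi} (h : IsCoprime γ.re γ.im) : IsCoprime (γ.re : Zi) γ := by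
  have h1 : IsCoprime (γ.re : Zi) (iZ * γ.im) :=
    (isCoprime_mul_unit_left_right (isUnit_of_pow_four iZ_pow_four) _ _).2 (isCoprime_intCast h)
  have h2 : γ = iZ * γ.im + γ.re * 1 := by ext <;> simp [iZ]
  conv_rhs => rw [h2]
  exact h1.add_mul_left_right 1

lemma qs_re_right {γ : Zi} (hγ : IsPrimary γ) (h : IsCoprime γ.re γ.im) :
    qs γ γ.re = (ZMod.χ₈ γ.re : ℤ) := by
  have ho := odd_norm_intCast hγ.odd_re
  have h2 : γ - iZ * γ.im = γ.re * 1 := by ext <;> simp [iZ]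
  rw [qs_congr _ ho ⟨1, h2⟩, qs_mul_left _ _ _ ho, qs_intCast_intCast hγ.odd_re h.symm, mul_one,
    qs_iZ_intCast hγ.odd_re]

lemma qs_re_left {γ : Zi} (hγ : IsPrimary γ) (h : IsCoprime γ.re γ.im) :
    qs (ZMod.χ₄ γ.re : ℤ) γ * qs γ.re γ = (ZMod.χ₈ γ.re : ℤ) := by
  rw [← qs_mul_left _ _ _ hγ.odd_norm, ← Int.cast_mul, ← qs_re_right hγ h]
  exact qs_signed hγ.odd_re hγ.odd_norm hγ.1 (isCoprime_intCast_re h).symm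
/-- Biquadratic reciprocity for the pair `α`, `β`. -/
def IsReciprocal (α β : Zi) : Prop :=
  qs α β = (-1) ^ (α.norm.natAbs / 4 * (β.norm.natAbs / 4)) * qs β α

lemma χ₈_re_mul {α β : Zi} (hα : IsPrimary α) (hβ : IsPrimary β) :
    ZMod.χ₈ α.re * ZMod.χ₈ β.re * ZMod.χ₈ (α.re * β.re + α.im * β.im : ℤ) =
      (-1) ^ (α.norm.natAbs / 4 * (β.norm.natAbs / 4)) := by
  have ha := χ₈_mul_self hα.odd_re
  have hb := χ₈_mul_self hβ.odd_re
  have h8 : ∀ m : ℤ, m % 8 = α.re * β.re % 8 → ZMod.χ₈ m = ZMod.χ₈ α.re * ZMod.χ₈ β.re := by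
    intro m hm
    rw [ZMod.χ₈_int_mod_eight, hm, ← ZMod.χ₈_int_mod_eight, Int.cast_mul, map_mul]
  obtain ⟨x, hx⟩ := hα.1
  obtain ⟨y, hy⟩ := hβ.1
  have hxy : α.im * β.im = 4 * (x * y) := by rw [hx, hy]; ring
  have hex : Even x ↔ 4 ∣ α.im := by rw [Int.even_iff]; omega
  have hey : Even y ↔ 4 ∣ β.im := by rw [Int.even_iff]; omega
  rw [← hα.natAbs_norm_div_four] at hex
  rw [← hβ.natAbs_norm_div_four] at hey
  by_cases h : Even (x * y)
  · have h' : Even (α.norm.natAbs / 4 * (β.norm.natAbs / 4)) := by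
      rwa [Nat.even_mul, ← hex, ← hey, ← Int.even_mul]
    rw [h'.neg_one_pow, h8 (α.re * β.re + α.im * β.im)]
    · linear_combination ha * ZMod.χ₈ β.re * ZMod.χ₈ β.re + hb
    · rw [Int.even_iff] at h
      omega
  · have h' : Odd (α.norm.natAbs / 4 * (β.norm.natAbs / 4)) := by
      rwa [← Nat.not_even_iff_odd, Nat.even_mul, ← hex, ← hey, ← Int.even_mul]
    have h4 : ZMod.χ₈ (α.re * β.re + α.im * β.im : ℤ) = - (ZMod.χ₈ α.re * ZMod.χ₈ β.re) := by
      have hneg : ∀ z : ZMod 8, ZMod.χ₈ (z + 4) = -ZMod.χ₈ z := by decide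
      have := hneg ((α.re * β.re + α.im * β.im : ℤ) : ZMod 8)
      rw [← h8 (α.re * β.re + α.im * β.im + 4) (by rw [Int.even_iff] at h; omega),
        Int.cast_add _ 4, Int.cast_ofNat, this, neg_neg]
    rw [h'.neg_one_pow, h4]
    linear_combination -(ha * ZMod.χ₈ β.re * ZMod.χ₈ β.re) - hb

lemma isReciprocal_of_isCoprime {α β : Zi} (hα : IsPrimary α) (hβ : IsPrimary β)
    (hα' : IsCoprime α.re α.im) (hβ' : IsCoprime β.re β.im) (h : IsCoprime α β) :
    IsReciprocal α β := by
  set m : ℤ := α.re * β.re + α.im * β.im with hm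
  set k : ℤ := α.re * β.im - α.im * β.re
  have hmo : Odd m := (hα.odd_re.mul hβ.odd_re).add_even (hα.1.mul_right _)
  have hmβ : β ∣ β.re * α - m := ⟨iZ * α.im, by ext <;> simp [iZ, m]; ring⟩
  have hmα : α ∣ α.re * β - m := ⟨iZ * β.im, by ext <;> simp [iZ, m]⟩
  have hcβ : IsCoprime (m : Zi) β := isCoprime_of_dvd_sub
    ((isCoprime_intCast_re hβ').mul_left h) (dvd_sub_comm.1 hmβ)
  have hcα : IsCoprime (m : Zi) α := isCoprime_of_dvd_sub
    ((isCoprime_intCast_re hα').mul_left h.symm) (dvd_sub_comm.1 hmα)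
  have hcα' : IsCoprime (m : Zi) (star α) := by
    simpa only [starRingEnd_apply, star_intCast] using hcα.map (starRingEnd Zi)
  have hc : IsCoprime (m : Zi) (β * star α) := hcβ.mul_right hcα'
  have hδo : Odd (β * star α).norm := odd_norm_mul.2 ⟨hβ.odd_norm, hα.star.odd_norm⟩
  have hδi : Even (β * star α).im := by
    rw [Zsqrtd.im_mul]
    exact (hα.star.1.mul_left _).add (hβ.1.mul_right _)
  have hδ : β * star α - iZ * k = m * 1 := by ext <;> simp [iZ, m, k] <;> ring
  have e1 := qs_congr β hβ.odd_norm hmβ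
  have e2 := qs_congr α hα.odd_norm hmα
  rw [qs_mul_left _ _ _ hβ.odd_norm] at e1
  rw [qs_mul_left _ _ _ hα.odd_norm] at e2
  have e3 : qs m (star α) = star (qs m α) := by
    rw [← qs_star _ _ hα.odd_norm, star_intCast]
  have e4 := qs_signed hmo hδo hδi hc.symm
  have hβ0 := ne_zero_of_odd_norm hβ.odd_norm
  have hα0 := ne_zero_of_odd_norm hα.star.odd_norm
  have hmno := odd_norm_intCast hmo
  have hck : IsCoprime k m := by
    have h1 : IsCoprime (iZ * (k : Zi)) m := isCoprime_of_dvd_sub hc.symm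
      (dvd_sub_comm.1 ⟨1, hδ⟩)
    exact isCoprime_of_intCast h1.of_mul_left_right
  rw [qs_congr _ hmno ⟨1, hδ⟩, qs_mul_left _ _ _ hmno, qs_intCast_intCast hmo hck, mul_one,
    qs_iZ_intCast hmo, signed, Int.cast_mul, qs_mul_left _ _ _ hδo,
    qs_mul_right _ hβ0 hα0, qs_mul_right _ hβ0 hα0, e3] at e4
  have e5 := qs_re_left hα hα'
  have e6 := qs_re_left hβ hβ'
  have hV := qs_mul_star hα.odd_norm h.symm
  have hsign : (qs (ZMod.χ₄ m : ℤ) β * qs (ZMod.χ₄ m : ℤ) (star α)) *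
      (qs (ZMod.χ₄ α.re : ℤ) α * qs (ZMod.χ₄ β.re : ℤ) β) = 1 ∧
      star (qs (ZMod.χ₄ α.re : ℤ) α) = qs (ZMod.χ₄ α.re : ℤ) α ∧
      qs (ZMod.χ₄ α.re : ℤ) α ^ 2 = 1 ∧ qs (ZMod.χ₄ β.re : ℤ) β ^ 2 = 1 := by
    have hm4 : ZMod.χ₄ m = ZMod.χ₄ α.re * ZMod.χ₄ β.re := by
      obtain ⟨x, hx⟩ := hα.1
      obtain ⟨y, hy⟩ := hβ.1
      have : m = α.re * β.re + 4 * (x * y) := by rw [hm, hx, hy]; ring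
      rw [← map_mul, ← Int.cast_mul, this, ZMod.χ₄_int_mod_four, Int.add_mul_emod_self_left,
        ← ZMod.χ₄_int_mod_four]
    have n1 := hα.qs_neg_one
    have n2 := hβ.qs_neg_one
    have n3 := hα.star.qs_neg_one
    have o1 := qs_one_left α hα.odd_norm
    have o2 := qs_one_left β hβ.odd_norm
    have o3 := qs_one_left _ hα.star.odd_norm
    rw [Zsqrtd.re_star] at n3
    rcases χ₄_eq_one_or hα.odd_re with hx | hx <;> rcases χ₄_eq_one_or hβ.odd_re with hy | hy <;>
      simp_all
  obtain ⟨s1, s2, s3, s4⟩ := hsign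
  have hXa := congrArg (Int.cast : ℤ → Zi) (χ₈_mul_self hα.odd_re)
  have hXc := congrArg (Int.cast : ℤ → Zi) (χ₈_mul_self hβ.odd_re)
  have hX := congrArg (Int.cast : ℤ → Zi) (χ₈_re_mul hα hβ)
  rw [IsReciprocal]
  rw [← hm] at hX
  simp only [Int.cast_mul, Int.cast_pow, Int.cast_neg, Int.cast_one] at hXa hXc hX
  rw [← hX]
  have e5' : qs α.re α = qs (ZMod.χ₄ α.re : ℤ) α * (ZMod.χ₈ α.re : ℤ) := by
    linear_combination qs (ZMod.χ₄ α.re : ℤ) α * e5 - qs α.re α * s3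
  have e6' : qs β.re β = qs (ZMod.χ₄ β.re : ℤ) β * (ZMod.χ₈ β.re : ℤ) := by
    linear_combination qs (ZMod.χ₄ β.re : ℤ) β * e6 - qs β.re β * s4
  rw [← e1, ← e2, e5', e6', star_mul', star_mul', s2, star_intCast] at e4
  generalize qs (ZMod.χ₄ m : ℤ) β * qs (ZMod.χ₄ m : ℤ) (star α) = s at *
  generalize qs (ZMod.χ₄ α.re : ℤ) α = x at *
  generalize qs (ZMod.χ₄ β.re : ℤ) β = y at *
  generalize ((ZMod.χ₈ α.re : ℤ) : Zi) = u at *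
  generalize ((ZMod.χ₈ β.re : ℤ) : Zi) = v at *
  generalize ((ZMod.χ₈ m : ℤ) : Zi) = w at *
  have e7 : u * v * qs α β * star (qs β α) = w := by
    linear_combination e4 - u * v * qs α β * star (qs β α) * s1
  linear_combination u * v * qs β α * e7 - u * u * v * v * qs α β * hV - v * v * qs α β * hXa -
    qs α β * hXc
lemma IsReciprocal.symm {α β : Zi} (h : IsReciprocal α β) : IsReciprocal β α := by
  rw [IsReciprocal] at h ⊢
  rw [h, ← mul_assoc, mul_comm (β.norm.natAbs / 4), ← mul_pow, neg_one_mul, neg_neg, one_pow,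
    one_mul]

lemma IsPrimary.intCast_mul {n : ℤ} (hn : n % 4 = 1) {α : Zi} (hα : IsPrimary α) :
    IsPrimary (n * α) := by
  obtain ⟨hi, l, hl⟩ := hα
  refine ⟨by simpa using hi.mul_left n, n * l + n / 4, ?_⟩
  have h1 : n = 4 * (n / 4) + 1 := by omega
  simp only [Zsqrtd.re_mul, Zsqrtd.im_mul,
    Zsqrtd.re_intCast, Zsqrtd.im_intCast]
  linear_combination n * hl + h1

lemma IsReciprocal.intCast_mul {n : ℤ} (hn : n % 4 = 1) {α β : Zi} (hα : IsPrimary α)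
    (hβ : IsPrimary β) (hco : IsCoprime (n : Zi) β) (h : IsReciprocal α β) :
    IsReciprocal (n * α) β := by
  have hno : Odd n := Int.odd_iff.2 (by omega)
  have hχ := ZMod.χ₄_int_one_mod_four hn
  have hR := qs_signed hno hβ.odd_norm hβ.1 hco.symm
  have hN : ((-1 : Zi)) ^ ((n * α : Zi).norm.natAbs / 4) = (-1) ^ (α.norm.natAbs / 4) := by
    have := (hα.intCast_mul hn).χ₄_re
    rw [show (n * α : Zi).re = n * α.re by simp, Int.cast_mul, map_mul, hχ, one_mul,
      hα.χ₄_re] at this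
    simpa using (congrArg (Int.cast : ℤ → Zi) this).symm
  rw [signed, hχ, one_mul] at hR
  rw [IsReciprocal] at h ⊢
  rw [pow_mul, hN, ← pow_mul, qs_mul_left _ _ _ hβ.odd_norm, hR, h,
    qs_mul_right _ (ne_zero_of_odd_norm (odd_norm_intCast hno)) (ne_zero_of_odd_norm hα.odd_norm)]
  ring

lemma IsPrimary.exists_eq_intCast_mul {γ : Zi} (h : IsPrimary γ) :
    ∃ (n : ℤ) (α : Zi), n % 4 = 1 ∧ IsPrimary α ∧ IsCoprime α.re α.im ∧ γ = n * α := by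
  have hre := h.odd_re
  have hg : 0 < Int.gcd γ.re γ.im := Int.gcd_pos_of_ne_zero_left _ (by rintro h0; simp [h0] at hre)
  obtain ⟨a, b, hab, ha, hb⟩ := Int.exists_gcd_one hg
  rw [← Int.isCoprime_iff_gcd_eq_one] at hab
  generalize ((Int.gcd γ.re γ.im : ℕ) : ℤ) = g at *
  obtain ⟨hi, l, hl⟩ := h
  rw [ha, Int.odd_mul] at hre
  have hb2 : Even b := by
    rw [hb, Int.even_mul] at hi
    exact hi.resolve_right (by rw [Int.not_even_iff_odd]; exact hre.2)
  have hg4 : g % 4 = 1 ∨ g % 4 = 3 := by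
    have := Int.odd_iff.1 hre.2
    omega
  rcases hg4 with hg4 | hg4
  · refine ⟨g, ⟨a, b⟩, hg4, ⟨hb2, l - (a + b) * (g / 4), ?_⟩, hab, ?_⟩
    · have h1 : g = 4 * (g / 4) + 1 := by omega
      simp only
      linear_combination hl - ha - hb - (a + b) * h1
    · ext <;> simp [ha, hb, mul_comm]
  · refine ⟨-g, ⟨-a, -b⟩, by omega, ⟨hb2.neg, l - (a + b) * (g / 4 + 1), ?_⟩, hab.neg_neg, ?_⟩
    · have h1 : g = 4 * (g / 4) + 3 := by omega
      simp only
      linear_combination hl - ha - hb - (a + b) * h1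
    · ext <;> simp [ha, hb, mul_comm]

lemma isReciprocal_of_isPrimary {α β : Zi} (hα : IsPrimary α) (hβ : IsPrimary β)
    (h : IsCoprime α β) : IsReciprocal α β := by
  obtain ⟨m, α, hm, hα', ha, rfl⟩ := hα.exists_eq_intCast_mul
  obtain ⟨n, β, hn, hβ', hb, rfl⟩ := hβ.exists_eq_intCast_mul
  refine .intCast_mul hm hα' hβ h.of_mul_left_left (.symm ?_)
  refine .intCast_mul hn hβ' hα' h.of_mul_left_right.of_mul_right_left.symm (.symm ?_)
  exact isReciprocal_of_isCoprime hα' hβ' ha hb h.of_mul_left_right.of_mul_right_right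

lemma isPrimary_of_lam_pow_dvd {γ : Zi} (h : lam ^ 3 ∣ γ - 1) : IsPrimary γ := by
  obtain ⟨t, ht⟩ := h
  have h3 : lam ^ 3 = ⟨-2, 2⟩ := by decide
  rw [h3] at ht
  have h1 := congrArg Zsqrtd.re ht
  have h2 := congrArg Zsqrtd.im ht
  simp at h1 h2
  exact ⟨⟨t.re - t.im, by linarith⟩, -t.im, by linarith⟩

lemma quarticSym_eq {α γ : Zi} (h : IsCoprime α γ) :
    quarticSym α γ = GaussianInt.toComplex (qs α γ) := by
  rw [quarticSym, if_pos h, qs, map_multiset_prod, Multiset.map_map]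
  rfl

lemma Ni_sub_one_div_four {γ : Zi} (h : IsPrimary γ) :
    (Ni γ - 1) / 4 = (γ.norm.natAbs / 4 : ℕ) := by
  have h4 := natAbs_norm_mod_four h.odd_norm
  have h0 := GaussianInt.abs_natCast_norm γ
  rw [Ni]
  omega

end Biquadratic

/-- biquadratic reciprocity. -/
theorem biquadratic_reciprocity (c₁ c₂ : Zi)
    (h₁ : lam ^ 3 ∣ c₁ - 1) (h₂ : lam ^ 3 ∣ c₂ - 1) (hco : IsCoprime c₁ c₂) :
    quarticSym c₁ c₂ =
      (-1 : ℂ) ^ ((Ni c₁ - 1) / 4 * ((Ni c₂ - 1) / 4)) * quarticSym c₂ c₁ := by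
  have p₁ := Biquadratic.isPrimary_of_lam_pow_dvd h₁
  have p₂ := Biquadratic.isPrimary_of_lam_pow_dvd h₂
  have h : Biquadratic.qs c₁ c₂ = _ := Biquadratic.isReciprocal_of_isPrimary p₁ p₂ hco
  rw [Biquadratic.quarticSym_eq hco, Biquadratic.quarticSym_eq hco.symm, h,
    Biquadratic.Ni_sub_one_div_four p₁, Biquadratic.Ni_sub_one_div_four p₂, ← Nat.cast_mul,
    zpow_natCast, map_mul, map_pow, map_neg, map_one]
end
end

section
/- Let π ∈ ℤ[i] be prime with π ≡ 1 (mod λ³), and let k, ℓ ∈ ℤ≥0. Then the quartic Gauss sum g₄(π^k, π^ℓ) equals: 1 if ℓ = 0; N(π)^k · g₄(1, π) if ℓ = k+1 and k ≡ 0 (mod 4); N(π)^k · g₂(1, π) if ℓ = k+1 and k ≡ 1 (mod 4); N(π)^k · (-1/π)₄ · conj(g₄(1, π)) if ℓ = k+1 and k ≡ 2 (mod 4); -N(π)^k if ℓ = k+1 and k ≡ 3 (mod 4); φ(π^ℓ) if k ≥ ℓ and ℓ ≡ 0 (mod 4); and 0 in all other cases. -/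
noncomputable section

open scoped Classical
open Complex

/-! ### Additive characters -/

lemma eCheck_add (a b : ℂ) : eCheck (a + b) = eCheck a * eCheck b := by
  rw [eCheck, eCheck, eCheck, ← Complex.exp_add, map_add]
  ring_nf

lemma eCheck_eq_exp_re (z : ℂ) : eCheck z = Complex.exp ((2 * z.re : ℝ) * (2 * Real.pi * I)) := by
  rw [eCheck, Complex.add_conj]
  ring_nf

lemma eCheck_eq_one_iff (z : ℂ) : eCheck z = 1 ↔ ∃ n : ℤ, 2 * z.re = n := by
  rw [eCheck_eq_exp_re, Complex.exp_eq_one_iff]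
  refine exists_congr fun n => ?_
  rw [mul_left_inj' Complex.two_pi_I_ne_zero]
  exact_mod_cast Iff.rfl

lemma eCheck_toComplex (w : Zi) : eCheck (GaussianInt.toComplex w) = 1 :=
  (eCheck_eq_one_iff _).2 ⟨2 * w.re, by simp⟩

lemma eCheck_congr {a b : ℂ} {w : Zi} (h : a = b + GaussianInt.toComplex w) :
    eCheck a = eCheck b := by
  rw [h, eCheck_add, eCheck_toComplex, mul_one]

lemma eCheck_div_congr {a b c : Zi} (hc : c ≠ 0) (h : c ∣ a - b) :
    eCheck (GaussianInt.toComplex a / GaussianInt.toComplex c) =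
      eCheck (GaussianInt.toComplex b / GaussianInt.toComplex c) := by
  obtain ⟨w, hw⟩ := h
  have hc' : GaussianInt.toComplex c ≠ 0 := by simpa [GaussianInt.toComplex_eq_zero] using hc
  apply eCheck_congr (w := w)
  rw [sub_eq_iff_eq_add.1 hw, map_add, map_mul]
  field_simp
  ring

lemma conj_eCheck (z : ℂ) : (starRingEnd ℂ) (eCheck z) = eCheck (-z) := by
  rw [eCheck, eCheck, ← Complex.exp_conj]
  simp only [map_mul, map_add, map_ofNat, Complex.conj_ofReal, Complex.conj_I, Complex.conj_conj,
    map_neg]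
  ring_nf

/-- If `z ↦ ě(z / c)` is trivial on `ℤ[i]`, then `c` divides `2`. -/
lemma dvd_two_of_eCheck_eq_one {c : Zi} (hc : c ≠ 0)
    (h : ∀ t : Zi, eCheck (GaussianInt.toComplex t / GaussianInt.toComplex c) = 1) : c ∣ 2 := by
  have hc' : GaussianInt.toComplex c ≠ 0 := by simpa [GaussianInt.toComplex_eq_zero] using hc
  obtain ⟨m, hm⟩ := (eCheck_eq_one_iff _).1 (h 1)
  obtain ⟨n, hn⟩ := (eCheck_eq_one_iff _).1 (h ⟨0, 1⟩)
  refine ⟨⟨m, -n⟩, ?_⟩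
  rw [← GaussianInt.toComplex_inj, map_mul]
  have hi : GaussianInt.toComplex (⟨0, 1⟩ : Zi) = I := by simp [GaussianInt.toComplex_def]
  rw [hi, div_eq_mul_inv, Complex.I_mul_re] at hn
  rw [map_one, one_div] at hm
  have : GaussianInt.toComplex ⟨m, -n⟩ = 2 * (GaussianInt.toComplex c)⁻¹ := by
    rw [GaussianInt.toComplex_def']
    apply Complex.ext
    · simp [← hm]
    · simp [← hn]
  rw [this, map_ofNat]
  field_simp

/-! ### Finite sums over groups -/

lemma sum_eq_zero_of_shift {G : Type*} [AddCommGroup G] [Fintype G] (f : G → ℂ) (t : G) {c : ℂ}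
    (hc : c ≠ 1) (h : ∀ x, f (x + t) = c * f x) : ∑ x, f x = 0 := by
  have h1 : ∑ x, f x = c * ∑ x, f x := by
    rw [Finset.mul_sum, ← Equiv.sum_comp (Equiv.addRight t) f]
    exact Finset.sum_congr rfl fun x _ => h x
  have h2 : (c - 1) * ∑ x, f x = 0 := by linear_combination -h1
  exact (mul_eq_zero.1 h2).resolve_left (sub_ne_zero.2 hc)

lemma exists_card_fiber {G H : Type*} [AddCommGroup G] [Fintype G] [AddCommGroup H] [Fintype H]
    (f : G →+ H) (hf : Function.Surjective f) :
    ∃ K : ℕ, Fintype.card G = K * Fintype.card H ∧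
      ∀ h : H → ℂ, ∑ x, h (f x) = K * ∑ y, h y := by
  have key : ∀ h : H → ℂ, ∑ x, h (f x) =
      (Finset.univ.filter fun x => f x = 0).card * ∑ y, h y := by
    intro h
    rw [← Finset.sum_fiberwise Finset.univ f, Finset.mul_sum]
    refine Finset.sum_congr rfl fun y _ => ?_
    rw [AddMonoidHom.card_fiber_eq_of_mem_range f ⟨0, map_zero f⟩ (hf y), ← nsmul_eq_mul]
    apply Finset.sum_eq_card_nsmul
    intro x hx
    rw [(Finset.mem_filter.1 hx).2]
  refine ⟨_, ?_, key⟩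
  have := key fun _ => 1
  simp only [Finset.sum_const, Finset.card_univ, nsmul_eq_mul, mul_one] at this
  exact_mod_cast this

/-! ### Cardinalities of quotients of the Gaussian integers -/

/-- The `ℤ`-basis `1, i` of the Gaussian integers. -/
def gaussianBasis : Module.Basis (Fin 2) ℤ Zi :=
  Module.Basis.ofEquivFun
    { toFun := fun z => ![z.re, z.im]
      invFun := fun v => ⟨v 0, v 1⟩
      left_inv := fun z => rfl
      right_inv := fun v => by ext i; fin_cases i <;> rfl
      map_add' := fun x y => by ext i; fin_cases i <;> simp
      map_smul' := fun n x => by ext i; fin_cases i <;> simp }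

lemma gaussianBasis_repr (x : Zi) (i : Fin 2) : gaussianBasis.repr x i = ![x.re, x.im] i := rfl

lemma algebraNorm_eq (x : Zi) : Algebra.norm ℤ x = Ni x := by
  rw [Algebra.norm_eq_matrix_det gaussianBasis, Matrix.det_fin_two]
  have h0 : gaussianBasis 0 = 1 := gaussianBasis.repr.injective (by
    ext i; rw [Module.Basis.repr_self]; fin_cases i <;> simp [gaussianBasis_repr])
  have h1 : gaussianBasis 1 = ⟨0, 1⟩ := gaussianBasis.repr.injective (by
    ext i; rw [Module.Basis.repr_self]; fin_cases i <;> simp [gaussianBasis_repr])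
  simp only [Algebra.leftMulMatrix_eq_repr_mul, h0, h1, gaussianBasis_repr]
  simp [Ni, Zsqrtd.norm_def]

instance : Module.Free ℤ Zi := Module.Free.of_basis gaussianBasis

instance : Module.Finite ℤ Zi := Module.Finite.of_basis gaussianBasis

lemma finite_quotient {c : Zi} (hc : c ≠ 0) : Finite (Zi ⧸ Ideal.span {c}) :=
  Ideal.finiteQuotientOfFreeOfNeBot _ (by simpa using hc)

lemma natCard_quotient (c : Zi) : (Nat.card (Zi ⧸ Ideal.span {c}) : ℤ) = Ni c := by
  have h := Ideal.absNorm_span_singleton c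
  rw [algebraNorm_eq, Ideal.absNorm_apply, Submodule.cardQuot_apply] at h
  rw [h]
  exact Int.natAbs_of_nonneg (GaussianInt.norm_nonneg c)

lemma Ni_pow (x : Zi) (n : ℕ) : Ni (x ^ n) = Ni x ^ n :=
  map_pow (Zsqrtd.normMonoidHom (d := -1)) x n

/-! ### The quartic residue symbol -/

lemma Ni_mod_four {π : Zi} (h : lam ^ 3 ∣ π - 1) : Ni π % 4 = 1 := by
  obtain ⟨⟨x, y⟩, hw⟩ := h
  have hl : lam ^ 3 = ⟨-2, 2⟩ := by decide
  rw [hl, Zsqrtd.ext_iff] at hw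
  simp at hw
  obtain ⟨h1, h2⟩ := hw
  have h3 : π.re = 1 - 2 * x - 2 * y := by linarith
  have h4 : π.im = 2 * x - 2 * y := by linarith
  have : Ni π = 4 * ((x + y) * (x + y - 1) + (x - y) ^ 2) + 1 := by
    rw [Ni, Zsqrtd.norm_def, h3, h4]; ring
  omega

lemma not_dvd_two {π : Zi} (hπ : Prime π) (h : lam ^ 3 ∣ π - 1) : ¬ π ∣ 2 := by
  intro h2
  have h3 : Zsqrtd.norm π ∣ Zsqrtd.norm (2 : Zi) := map_dvd (Zsqrtd.normMonoidHom (d := -1)) h2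
  have h5 : Zsqrtd.norm (2 : Zi) = 4 := by decide
  have h4 := Ni_mod_four h
  have hn : ¬ IsUnit (Zsqrtd.norm π) := fun hu =>
    hπ.not_isUnit ((Zsqrtd.isUnit_iff_norm_isUnit π).2 hu)
  rw [h5] at h3
  rw [Ni] at h4
  have h6 := GaussianInt.norm_nonneg π
  have h7 := Int.le_of_dvd (by norm_num) h3
  generalize Zsqrtd.norm π = N at *
  have : N = 1 := by omega
  exact hn (this ▸ isUnit_one)

lemma pow_four_eq_one {u : Zi} (h : u ^ 4 = 1) :
    u = 1 ∨ u = -1 ∨ u = ⟨0, 1⟩ ∨ u = ⟨0, -1⟩ := by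
  have h1 : (u - 1) * ((u + 1) * ((u - ⟨0, 1⟩) * (u - ⟨0, -1⟩))) = 0 := by
    have hi : (⟨0, 1⟩ : Zi) * ⟨0, -1⟩ = 1 := by decide
    have hs : (⟨0, 1⟩ : Zi) + ⟨0, -1⟩ = 0 := by decide
    linear_combination h + (u ^ 2 - 1) * hi - u * (u ^ 2 - 1) * hs
  rcases mul_eq_zero.1 h1 with h | h
  · exact Or.inl (sub_eq_zero.1 h)
  rcases mul_eq_zero.1 h with h | h
  · exact Or.inr (Or.inl (eq_neg_of_add_eq_zero_left h))
  rcases mul_eq_zero.1 h with h | h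
  · exact Or.inr (Or.inr (Or.inl (sub_eq_zero.1 h)))
  · exact Or.inr (Or.inr (Or.inr (sub_eq_zero.1 h)))

/-- Fourth roots of unity are distinct modulo `π`. -/
lemma root_unique {π u v : Zi} (hπ : Prime π) (h : lam ^ 3 ∣ π - 1) (hu : u ^ 4 = 1)
    (hv : v ^ 4 = 1) (huv : π ∣ u - v) : u = v := by
  by_contra hne
  have : (u - v) ∣ 2 := by
    rcases pow_four_eq_one hu with rfl | rfl | rfl | rfl <;>
    rcases pow_four_eq_one hv with rfl | rfl | rfl | rfl <;>
    first
    | exact absurd rfl hne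
    | exact ⟨1, by decide⟩
    | exact ⟨-1, by decide⟩
    | exact ⟨⟨1, 1⟩, by decide⟩
    | exact ⟨⟨1, -1⟩, by decide⟩
    | exact ⟨⟨-1, 1⟩, by decide⟩
    | exact ⟨⟨-1, -1⟩, by decide⟩
    | exact ⟨⟨0, 1⟩, by decide⟩
    | exact ⟨⟨0, -1⟩, by decide⟩
  exact not_dvd_two hπ h (huv.trans this)

lemma quotient_isMaximal {π : Zi} (hπ : Prime π) : (Ideal.span {π}).IsMaximal :=
  PrincipalIdealRing.isMaximal_of_irreducible hπ.irreducible

lemma dvd_pow_sub_one {π α : Zi} (hπ : Prime π) (hα : ¬ π ∣ α) :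
    π ∣ α ^ (Ni π - 1).toNat - 1 := by
  have := quotient_isMaximal hπ
  let := Ideal.Quotient.field (Ideal.span {π})
  have := finite_quotient hπ.ne_zero
  let := Fintype.ofFinite (Zi ⧸ Ideal.span {π})
  have hc : (Ni π - 1).toNat = Fintype.card (Zi ⧸ Ideal.span {π}) - 1 := by
    rw [← natCard_quotient, Nat.card_eq_fintype_card]; omega
  rw [← Ideal.Quotient.eq_zero_iff_dvd, map_sub, map_pow, map_one, hc,
    FiniteField.pow_card_sub_one_eq_one, sub_self]
  rwa [Ne, Ideal.Quotient.eq_zero_iff_dvd]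

lemma exists_root {π α : Zi} (hπ : Prime π) (h : lam ^ 3 ∣ π - 1) (hα : ¬ π ∣ α) :
    ∃ u : Zi, u ^ 4 = 1 ∧ π ∣ α ^ ((Ni π - 1) / 4).toNat - u := by
  have h4 := Ni_mod_four h
  have hN := GaussianInt.norm_nonneg π
  have he : (Ni π - 1).toNat = ((Ni π - 1) / 4).toNat * 4 := by
    rw [Ni] at *; omega
  have hd := dvd_pow_sub_one hπ hα
  rw [he, pow_mul] at hd
  generalize α ^ ((Ni π - 1) / 4).toNat = b at *
  have h1 : b ^ 4 - 1 = (b - 1) * ((b - (-1)) * ((b - ⟨0, 1⟩) * (b - ⟨0, -1⟩))) := by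
    have hi : (⟨0, 1⟩ : Zi) * ⟨0, -1⟩ = 1 := by decide
    have hs : (⟨0, 1⟩ : Zi) + ⟨0, -1⟩ = 0 := by decide
    linear_combination - (b ^ 2 - 1) * hi + b * (b ^ 2 - 1) * hs
  rw [h1] at hd
  rcases hπ.dvd_or_dvd hd with hd | hd
  · exact ⟨1, by decide, hd⟩
  rcases hπ.dvd_or_dvd hd with hd | hd
  · exact ⟨-1, by decide, hd⟩
  rcases hπ.dvd_or_dvd hd with hd | hd
  · exact ⟨_, by decide, hd⟩
  · exact ⟨_, by decide, hd⟩

lemma quarticPrime_spec {π α : Zi} (hπ : Prime π) (h : lam ^ 3 ∣ π - 1) (hα : ¬ π ∣ α) :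
    quarticPrime α π ^ 4 = 1 ∧ π ∣ α ^ ((Ni π - 1) / 4).toNat - quarticPrime α π := by
  rw [quarticPrime, dif_pos (exists_root hπ h hα)]
  exact (exists_root hπ h hα).choose_spec

lemma quarticPrime_eq {π α u : Zi} (hπ : Prime π) (h : lam ^ 3 ∣ π - 1) (hα : ¬ π ∣ α)
    (hu : u ^ 4 = 1) (hd : π ∣ α ^ ((Ni π - 1) / 4).toNat - u) : quarticPrime α π = u := by
  obtain ⟨h1, h2⟩ := quarticPrime_spec hπ h hα
  refine root_unique hπ h h1 hu ?_
  have := dvd_sub hd h2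
  rwa [sub_sub_sub_cancel_left] at this

lemma quarticPrime_associated {π p : Zi} (α : Zi) (hp : Associated p π) :
    quarticPrime α p = quarticPrime α π := by
  have hn : Ni p = Ni π := by
    obtain ⟨u, rfl⟩ := hp
    have hu : Zsqrtd.norm (u : Zi) = 1 := (Zsqrtd.norm_eq_one_iff' (by norm_num) _).2 u.isUnit
    rw [Ni, Ni, Zsqrtd.norm_mul, hu, mul_one]
  simp only [quarticPrime, hn, hp.dvd_iff_dvd_left]

lemma isCoprime_pow_iff {π α : Zi} (hπ : Prime π) {n : ℕ} (hn : n ≠ 0) :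
    IsCoprime α (π ^ n) ↔ ¬ π ∣ α := by
  rw [IsCoprime.pow_right_iff (Nat.pos_of_ne_zero hn), isCoprime_comm,
    hπ.irreducible.coprime_iff_not_dvd]

lemma quarticSym_pow_of_dvd {π α : Zi} (hπ : Prime π) {n : ℕ} (hn : n ≠ 0) (hα : π ∣ α) :
    quarticSym α (π ^ n) = 0 :=
  if_neg ((isCoprime_pow_iff hπ hn).not.2 (not_not.2 hα))

lemma quarticSym_pow {π α : Zi} (hπ : Prime π) {n : ℕ} (hn : n ≠ 0) (hα : ¬ π ∣ α) :
    quarticSym α (π ^ n) = GaussianInt.toComplex (quarticPrime α π) ^ n := by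
  rw [quarticSym, if_pos ((isCoprime_pow_iff hπ hn).2 hα)]
  have hrel : Multiset.Rel Associated (UniqueFactorizationMonoid.factors (π ^ n))
      (Multiset.replicate n π) := by
    refine UniqueFactorizationMonoid.factors_unique
      (fun x hx => UniqueFactorizationMonoid.irreducible_of_factor x hx) (fun x hx => ?_) ?_
    · rw [Multiset.eq_of_mem_replicate hx]; exact hπ.irreducible
    · rw [Multiset.prod_replicate]
      exact UniqueFactorizationMonoid.factors_prod (pow_ne_zero n hπ.ne_zero)
  obtain ⟨hc, hm⟩ := Multiset.rel_replicate_right.1 hrel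
  rw [Multiset.map_congr rfl fun p hp => by rw [quarticPrime_associated α (hm p hp)],
    Multiset.map_const', Multiset.prod_replicate, hc]

lemma quarticSym_prime {π α : Zi} (hπ : Prime π) (hα : ¬ π ∣ α) :
    quarticSym α π = GaussianInt.toComplex (quarticPrime α π) := by
  simpa using quarticSym_pow hπ one_ne_zero hα

lemma quarticSym_prime_of_dvd {π α : Zi} (hπ : Prime π) (hα : π ∣ α) : quarticSym α π = 0 := by
  simpa using quarticSym_pow_of_dvd hπ one_ne_zero hα

lemma quarticSym_pow_eq {π : Zi} (hπ : Prime π) {n : ℕ} (hn : n ≠ 0) (α : Zi) :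
    quarticSym α (π ^ n) = quarticSym α π ^ n := by
  by_cases hα : π ∣ α
  · rw [quarticSym_pow_of_dvd hπ hn hα, quarticSym_prime_of_dvd hπ hα, zero_pow hn]
  · rw [quarticSym_pow hπ hn hα, quarticSym_prime hπ hα]

lemma quarticSym_pow_four {π α : Zi} (hπ : Prime π) (h : lam ^ 3 ∣ π - 1) (hα : ¬ π ∣ α) :
    quarticSym α π ^ 4 = 1 := by
  rw [quarticSym_prime hπ hα, ← map_pow, (quarticPrime_spec hπ h hα).1, map_one]

lemma quarticSym_congr {π α β : Zi} (hπ : Prime π) (h : lam ^ 3 ∣ π - 1) (hd : π ∣ α - β) :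
    quarticSym α π = quarticSym β π := by
  have hiff := dvd_iff_dvd_of_dvd_sub hd
  by_cases hα : π ∣ α
  · rw [quarticSym_prime_of_dvd hπ hα, quarticSym_prime_of_dvd hπ (hiff.1 hα)]
  have hβ := hiff.not.1 hα
  rw [quarticSym_prime hπ hα, quarticSym_prime hπ hβ]
  obtain ⟨h1, h2⟩ := quarticPrime_spec hπ h hβ
  rw [quarticPrime_eq hπ h hα h1]
  have := dvd_add (hd.trans (sub_dvd_pow_sub_pow α β ((Ni π - 1) / 4).toNat)) h2
  rwa [sub_add_sub_cancel] at this

lemma quarticSym_mul {π : Zi} (hπ : Prime π) (h : lam ^ 3 ∣ π - 1) (α β : Zi) :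
    quarticSym (α * β) π = quarticSym α π * quarticSym β π := by
  by_cases hα : π ∣ α
  · rw [quarticSym_prime_of_dvd hπ hα, quarticSym_prime_of_dvd hπ (hα.mul_right β), zero_mul]
  by_cases hβ : π ∣ β
  · rw [quarticSym_prime_of_dvd hπ hβ, quarticSym_prime_of_dvd hπ (hβ.mul_left α), mul_zero]
  have hαβ : ¬ π ∣ α * β := fun hd => (hπ.dvd_or_dvd hd).elim hα hβ
  rw [quarticSym_prime hπ hα, quarticSym_prime hπ hβ, quarticSym_prime hπ hαβ, ← map_mul]
  obtain ⟨h1, h2⟩ := quarticPrime_spec hπ h hα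
  obtain ⟨h3, h4⟩ := quarticPrime_spec hπ h hβ
  rw [quarticPrime_eq hπ h hαβ (u := quarticPrime α π * quarticPrime β π)]
  · rw [mul_pow, h1, h3, one_mul]
  · rw [← Ideal.Quotient.eq_zero_iff_dvd, map_sub, sub_eq_zero] at *
    rw [mul_pow, map_mul, map_mul, h2, h4]

lemma quarticSym_one {π : Zi} (hπ : Prime π) (h : lam ^ 3 ∣ π - 1) : quarticSym 1 π = 1 := by
  have h1 : ¬ π ∣ 1 := fun hd => hπ.not_isUnit (isUnit_of_dvd_one hd)
  rw [quarticSym_prime hπ h1, quarticPrime_eq hπ h h1 (one_pow 4) (by simp), map_one]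

lemma dvd_out_sub {c : Zi} (d : Zi) :
    c ∣ Quotient.out (Ideal.Quotient.mk (Ideal.span {c}) d) - d := by
  rw [← Ideal.Quotient.eq_zero_iff_dvd, map_sub, Ideal.Quotient.mk_out, sub_self]

/-- The quartic residue symbol modulo `π` as a multiplicative character. -/
def quarticChar {π : Zi} (hπ : Prime π) (h : lam ^ 3 ∣ π - 1) :
    MulChar (Zi ⧸ Ideal.span {π}) ℂ where
  toFun x := quarticSym (Quotient.out x) π
  map_one' := (quarticSym_congr hπ h (dvd_out_sub 1)).trans (quarticSym_one hπ h)
  map_mul' x y := by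
    rw [← quarticSym_mul hπ h]
    apply quarticSym_congr hπ h
    rw [← Ideal.Quotient.eq_zero_iff_dvd, map_sub, map_mul]
    simp only [Ideal.Quotient.mk_out, sub_self]
  map_nonunit' x hx := by
    apply quarticSym_prime_of_dvd hπ
    by_contra hd
    apply hx
    have := quotient_isMaximal hπ
    let := Ideal.Quotient.field (Ideal.span {π})
    rw [← Ideal.Quotient.eq_zero_iff_dvd, Ideal.Quotient.mk_out] at hd
    exact isUnit_iff_ne_zero.2 hd

lemma quarticChar_mk {π : Zi} (hπ : Prime π) (h : lam ^ 3 ∣ π - 1) (d : Zi) :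
    quarticChar hπ h (Ideal.Quotient.mk _ d) = quarticSym d π :=
  quarticSym_congr hπ h (dvd_out_sub d)

lemma quarticChar_pow_four {π : Zi} (hπ : Prime π) (h : lam ^ 3 ∣ π - 1)
    {x : Zi ⧸ Ideal.span {π}} (hx : x ≠ 0) : quarticChar hπ h x ^ 4 = 1 := by
  apply quarticSym_pow_four hπ h
  rwa [← Ideal.Quotient.eq_zero_iff_dvd, Ideal.Quotient.mk_out]

lemma quarticChar_pow_eq_one {π : Zi} (hπ : Prime π) (h : lam ^ 3 ∣ π - 1)
    {x : Zi ⧸ Ideal.span {π}} (hx : x ≠ 0) {n : ℕ} (hn : n % 4 = 0) :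
    quarticChar hπ h x ^ n = 1 := by
  obtain ⟨m, rfl⟩ := Nat.dvd_of_mod_eq_zero hn
  rw [pow_mul, quarticChar_pow_four hπ h hx, one_pow]

lemma quarticChar_zero {π : Zi} (hπ : Prime π) (h : lam ^ 3 ∣ π - 1) :
    quarticChar hπ h 0 = 0 := by
  apply quarticSym_prime_of_dvd hπ
  rw [← Ideal.Quotient.eq_zero_iff_dvd, Ideal.Quotient.mk_out]

/-- The quartic residue symbol has order exactly four. -/
lemma quarticChar_pow_ne_one {π : Zi} (hπ : Prime π) (h : lam ^ 3 ∣ π - 1) {j : ℕ}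
    (hj : j % 4 ≠ 0) : quarticChar hπ h ^ j ≠ 1 := by
  intro hone
  have := quotient_isMaximal hπ
  let := Ideal.Quotient.field (Ideal.span {π})
  have := finite_quotient hπ.ne_zero
  obtain ⟨g, hg⟩ := IsCyclic.exists_generator (α := (Zi ⧸ Ideal.span {π})ˣ)
  obtain ⟨α, hα⟩ := Ideal.Quotient.mk_surjective (g : Zi ⧸ Ideal.span {π})
  have hnd : ¬ π ∣ α := by
    rw [← Ideal.Quotient.eq_zero_iff_dvd, hα]; exact g.ne_zero
  have h1 : (quarticChar hπ h ^ j) g = 1 := by rw [hone, MulChar.one_apply_coe]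
  rw [MulChar.pow_apply_coe, ← hα, quarticChar_mk, quarticSym_prime hπ hnd, ← map_pow,
    ← map_one GaussianInt.toComplex, GaussianInt.toComplex_inj] at h1
  have h2 := (quarticPrime_spec hπ h hnd).2
  rw [← Ideal.Quotient.eq_zero_iff_dvd, map_sub, sub_eq_zero, map_pow, hα] at h2
  have h3 : g ^ (((Ni π - 1) / 4).toNat * j) = 1 := by
    ext
    rw [Units.val_pow_eq_pow_val, pow_mul, h2, ← map_pow, h1, map_one, Units.val_one]
  have h4 := orderOf_dvd_of_pow_eq_one h3
  rw [orderOf_eq_card_of_forall_mem_zpowers hg, Nat.card_units] at h4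
  have hmod := Ni_mod_four h
  have hcard := natCard_quotient π
  have hgt : 1 < Nat.card (Zi ⧸ Ideal.span {π}) := Finite.one_lt_card
  obtain ⟨m, hm⟩ : ∃ m : ℕ, Nat.card (Zi ⧸ Ideal.span {π}) - 1 = m * 4 :=
    ⟨(Nat.card (Zi ⧸ Ideal.span {π}) - 1) / 4, by omega⟩
  have hm' : ((Ni π - 1) / 4).toNat = m := by omega
  rw [hm, hm'] at h4
  have h5 := Nat.dvd_of_mul_dvd_mul_left (by omega) h4
  omega

/-! ### Gauss sums -/

lemma g4_zero_exponent (ν : ℂ) (π : Zi) (hν : ∃ w : Zi, ν = GaussianInt.toComplex w) :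
    g4 ν (π ^ 0) = 1 := by
  obtain ⟨w, rfl⟩ := hν
  have hs : Subsingleton (Zi ⧸ Ideal.span {π ^ 0}) := by
    rw [pow_zero, Ideal.span_singleton_one]
    exact Ideal.Quotient.subsingleton_iff.2 rfl
  rw [g4, finsum_eq_single _ 0 fun x hx => absurd (Subsingleton.elim x 0) hx, pow_zero, map_one,
    div_one, ← map_mul, eCheck_toComplex, mul_one, quarticSym, if_pos isCoprime_one_right]
  simp

section

variable {π : Zi} (hπ : Prime π) (h : lam ^ 3 ∣ π - 1)

/-- The reduction map from residues modulo `π ^ ℓ` to residues modulo `π`. -/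
def reduction (π : Zi) {ℓ : ℕ} (hℓ : ℓ ≠ 0) :
    (Zi ⧸ Ideal.span {π ^ ℓ}) →+* (Zi ⧸ Ideal.span {π}) :=
  Ideal.Quotient.factor (Ideal.span_singleton_le_span_singleton.2 (dvd_pow_self π hℓ))

lemma reduction_mk (π : Zi) {ℓ : ℕ} (hℓ : ℓ ≠ 0) (d : Zi) :
    reduction π hℓ (Ideal.Quotient.mk _ d) = Ideal.Quotient.mk _ d := rfl

lemma mk_out_eq_reduction {ℓ : ℕ} (hℓ : ℓ ≠ 0) (x : Zi ⧸ Ideal.span {π ^ ℓ}) :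
    Ideal.Quotient.mk (Ideal.span {π}) (Quotient.out x) = reduction π hℓ x := by
  rw [← reduction_mk π hℓ, Ideal.Quotient.mk_out]

lemma reduction_surjective (π : Zi) {ℓ : ℕ} (hℓ : ℓ ≠ 0) :
    Function.Surjective (reduction π hℓ) := Ideal.Quotient.factor_surjective _

include hπ in
lemma isUnit_iff_reduction_ne_zero {ℓ : ℕ} (hℓ : ℓ ≠ 0) (x : Zi ⧸ Ideal.span {π ^ ℓ}) :
    IsUnit x ↔ reduction π hℓ x ≠ 0 := by
  obtain ⟨d, rfl⟩ := Ideal.Quotient.mk_surjective x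
  rw [Ne, reduction_mk, Ideal.Quotient.eq_zero_iff_dvd, ← isCoprime_pow_iff hπ hℓ]
  constructor
  · intro hu
    obtain ⟨y, hy⟩ := hu.exists_right_inv
    obtain ⟨e, rfl⟩ := Ideal.Quotient.mk_surjective y
    rw [← map_mul, ← map_one (Ideal.Quotient.mk _), Ideal.Quotient.eq,
      Ideal.mem_span_singleton] at hy
    obtain ⟨w, hw⟩ := hy
    exact ⟨e, -w, by linear_combination hw⟩
  · rintro ⟨a, b, hab⟩
    refine IsUnit.of_mul_eq_one (Ideal.Quotient.mk _ a) ?_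
    rw [← map_mul, ← map_one (Ideal.Quotient.mk _), Ideal.Quotient.eq, Ideal.mem_span_singleton]
    exact ⟨-b, by linear_combination hab⟩

/-- A quartic Gauss sum to a prime power modulus in terms of the quartic character. -/
lemma g4_eq_sum {ℓ : ℕ} (hℓ : ℓ ≠ 0) [Fintype (Zi ⧸ Ideal.span {π ^ ℓ})] (ν : ℂ) :
    g4 ν (π ^ ℓ) = ∑ x : Zi ⧸ Ideal.span {π ^ ℓ}, quarticChar hπ h (reduction π hℓ x) ^ ℓ *
      eCheck (ν * GaussianInt.toComplex (Quotient.out x) / GaussianInt.toComplex (π ^ ℓ)) := by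
  rw [g4, finsum_eq_sum_of_fintype]
  refine Finset.sum_congr rfl fun x _ => ?_
  rw [quarticSym_pow_eq hπ hℓ, ← mk_out_eq_reduction, quarticChar_mk]

/-- The additive character `d ↦ ě(d / π)` on residues modulo `π`. -/
def addCharMod (π : Zi) (y : Zi ⧸ Ideal.span {π}) : ℂ :=
  eCheck (GaussianInt.toComplex (Quotient.out y) / GaussianInt.toComplex π)

include hπ in
lemma addCharMod_mk (d : Zi) : addCharMod π (Ideal.Quotient.mk _ d) =
    eCheck (GaussianInt.toComplex d / GaussianInt.toComplex π) :=
  eCheck_div_congr hπ.ne_zero (dvd_out_sub d)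

lemma g4_one_eq_sum [Fintype (Zi ⧸ Ideal.span {π})] :
    g4 1 π = ∑ y, quarticChar hπ h y * addCharMod π y := by
  rw [g4, finsum_eq_sum_of_fintype]
  simp only [one_mul]
  rfl

lemma g2_one_eq_sum [Fintype (Zi ⧸ Ideal.span {π})] :
    g2 1 π = ∑ y, quarticChar hπ h y ^ 2 * addCharMod π y := by
  rw [g2, finsum_eq_sum_of_fintype]
  simp only [one_mul]
  rfl

lemma conj_g4_one [Fintype (Zi ⧸ Ideal.span {π})] :
    quarticSym (-1) π * (starRingEnd ℂ) (g4 1 π) =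
      ∑ y, quarticChar hπ h y ^ 3 * addCharMod π y := by
  rw [g4_one_eq_sum hπ h, map_sum, Finset.mul_sum, ← Equiv.sum_comp (Equiv.neg _)]
  refine Finset.sum_congr rfl fun y _ => ?_
  obtain ⟨d, rfl⟩ := Ideal.Quotient.mk_surjective y
  rw [Equiv.neg_apply, map_mul, ← map_neg, addCharMod_mk hπ, addCharMod_mk hπ, conj_eCheck,
    map_neg GaussianInt.toComplex, neg_div, neg_neg, ← mul_assoc, quarticChar_mk, quarticChar_mk]
  congr 1
  by_cases hd : π ∣ d
  · rw [quarticSym_prime_of_dvd hπ hd, quarticSym_prime_of_dvd hπ ((dvd_neg).2 hd)]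
    simp
  have h4 := quarticSym_pow_four hπ h ((dvd_neg (a := π) (b := d)).not.2 hd)
  have hconj : (starRingEnd ℂ) (quarticSym (-d) π) = quarticSym (-d) π ^ 3 := by
    have hn := Complex.norm_eq_one_of_pow_eq_one h4 (by norm_num)
    rw [← Complex.inv_eq_conj hn]
    exact inv_eq_of_mul_eq_one_left (by rw [← h4]; ring)
  have h1 : ¬ π ∣ -1 := fun hd => hπ.not_isUnit (isUnit_of_dvd_unit hd isUnit_one.neg)
  rw [hconj, ← neg_one_mul d, quarticSym_mul hπ h, mul_pow]
  linear_combination quarticSym d π ^ 3 * quarticSym_pow_four hπ h h1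

include hπ h in
lemma exists_eCheck_ne_one {n : ℕ} (hn : n ≠ 0) :
    ∃ t : Zi, eCheck (GaussianInt.toComplex t / GaussianInt.toComplex (π ^ n)) ≠ 1 := by
  by_contra! hall
  have hd := dvd_two_of_eCheck_eq_one (pow_ne_zero n hπ.ne_zero) hall
  exact not_dvd_two hπ h ((dvd_pow_self π hn).trans hd)

include hπ h in
lemma sum_addCharMod [Fintype (Zi ⧸ Ideal.span {π})] : ∑ y, addCharMod π y = 0 := by
  obtain ⟨t, ht⟩ := exists_eCheck_ne_one hπ h one_ne_zero
  rw [pow_one] at ht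
  refine sum_eq_zero_of_shift _ (Ideal.Quotient.mk _ t) ht fun x => ?_
  obtain ⟨d, rfl⟩ := Ideal.Quotient.mk_surjective x
  rw [← map_add, addCharMod_mk hπ, addCharMod_mk hπ, map_add, add_div, eCheck_add, mul_comm]

lemma sum_quarticChar_pow_mul_addCharMod [Fintype (Zi ⧸ Ideal.span {π})] {n : ℕ} (hn : n ≠ 0)
    (h4 : n % 4 = 0) : ∑ y, quarticChar hπ h y ^ n * addCharMod π y = -1 := by
  have hzero : addCharMod π 0 = 1 := by
    rw [← map_zero (Ideal.Quotient.mk _), addCharMod_mk hπ, map_zero, zero_div,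
      ← map_zero GaussianInt.toComplex, eCheck_toComplex]
  have hterm : ∀ y, quarticChar hπ h y ^ n * addCharMod π y =
      addCharMod π y - if y = 0 then 1 else 0 := by
    intro y
    by_cases hy : y = 0
    · rw [hy, quarticChar_zero, zero_pow hn, hzero]; simp
    · rw [quarticChar_pow_eq_one hπ h hy h4, one_mul, if_neg hy, sub_zero]
  simp only [hterm, Finset.sum_sub_distrib, sum_addCharMod hπ h]
  simp

lemma quarticChar_pow_add_four (y : Zi ⧸ Ideal.span {π}) {n : ℕ} (hn : n ≠ 0) (m : ℕ) :
    quarticChar hπ h y ^ (4 * m + n) = quarticChar hπ h y ^ n := by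
  by_cases hy : y = 0
  · rw [hy, quarticChar_zero, zero_pow hn, zero_pow (by omega)]
  · rw [pow_add, pow_mul, quarticChar_pow_four hπ h hy, one_pow, one_mul]

lemma natCard_quotient_pow (π : Zi) (n : ℕ) :
    Nat.card (Zi ⧸ Ideal.span {π ^ n}) = Nat.card (Zi ⧸ Ideal.span {π}) ^ n := by
  have h1 := natCard_quotient (π ^ n)
  rw [Ni_pow, ← natCard_quotient] at h1
  exact_mod_cast h1

/-- The Gauss sum with modulus one power above the numerator descends to residues modulo `π`. -/
lemma g4_succ [Fintype (Zi ⧸ Ideal.span {π})] (k : ℕ) :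
    g4 (GaussianInt.toComplex (π ^ k)) (π ^ (k + 1)) =
      (Ni π : ℂ) ^ k * ∑ y, quarticChar hπ h y ^ (k + 1) * addCharMod π y := by
  have := finite_quotient (pow_ne_zero (k + 1) hπ.ne_zero)
  let := Fintype.ofFinite (Zi ⧸ Ideal.span {π ^ (k + 1)})
  have hℓ := Nat.succ_ne_zero k
  have hπ' : GaussianInt.toComplex π ≠ 0 := by
    simpa [GaussianInt.toComplex_eq_zero] using hπ.ne_zero
  obtain ⟨K, hK, hsum⟩ := exists_card_fiber (reduction π hℓ).toAddMonoidHom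
    (reduction_surjective π hℓ)
  have hKN : (K : ℂ) = (Ni π : ℂ) ^ k := by
    rw [← Nat.card_eq_fintype_card, ← Nat.card_eq_fintype_card, natCard_quotient_pow,
      pow_succ] at hK
    have hpos : 0 < Nat.card (Zi ⧸ Ideal.span {π}) := by
      rw [Nat.card_eq_fintype_card]; exact Fintype.card_pos
    rw [← Nat.eq_of_mul_eq_mul_right hpos hK, ← natCard_quotient]
    push_cast
    rfl
  rw [g4_eq_sum hπ h hℓ, ← hKN, ← hsum]
  refine Finset.sum_congr rfl fun x _ => ?_
  change _ = quarticChar hπ h (reduction π hℓ x) ^ (k + 1) * addCharMod π (reduction π hℓ x)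
  rw [← mk_out_eq_reduction hℓ x, addCharMod_mk hπ]
  congr 2
  simp only [map_pow]
  rw [pow_succ (GaussianInt.toComplex π) k]
  field_simp

lemma g4_of_le {k ℓ : ℕ} (hℓ : ℓ ≠ 0) (hk : ℓ ≤ k) [Fintype (Zi ⧸ Ideal.span {π ^ ℓ})] :
    g4 (GaussianInt.toComplex (π ^ k)) (π ^ ℓ) =
      ∑ x : Zi ⧸ Ideal.span {π ^ ℓ}, quarticChar hπ h (reduction π hℓ x) ^ ℓ := by
  rw [g4_eq_sum hπ h hℓ]
  refine Finset.sum_congr rfl fun x _ => ?_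
  obtain ⟨m, rfl⟩ := Nat.exists_eq_add_of_le hk
  have hπ' : GaussianInt.toComplex (π ^ ℓ) ≠ 0 := by
    simpa [GaussianInt.toComplex_eq_zero] using fun h0 => absurd h0 hπ.ne_zero
  rw [pow_add, map_mul, mul_assoc, mul_div_cancel_left₀ _ hπ', ← map_mul, eCheck_toComplex,
    mul_one]

include hπ h in
lemma g4_of_le_of_dvd {k ℓ : ℕ} (hℓ : ℓ ≠ 0) (hk : ℓ ≤ k) (h4 : ℓ % 4 = 0) :
    g4 (GaussianInt.toComplex (π ^ k)) (π ^ ℓ) = phiZ (π ^ ℓ) := by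
  have := finite_quotient (pow_ne_zero ℓ hπ.ne_zero)
  let := Fintype.ofFinite (Zi ⧸ Ideal.span {π ^ ℓ})
  have hterm : ∀ x : Zi ⧸ Ideal.span {π ^ ℓ},
      quarticChar hπ h (reduction π hℓ x) ^ ℓ = if IsUnit x then 1 else 0 := by
    intro x
    have hu := isUnit_iff_reduction_ne_zero hπ hℓ x
    by_cases hx : reduction π hℓ x = 0
    · rw [hx, quarticChar_zero, zero_pow hℓ, if_neg fun hc => hu.1 hc hx]
    · rw [if_pos (hu.2 hx), quarticChar_pow_eq_one hπ h hx h4]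
  rw [g4_of_le hπ h hℓ hk, Finset.sum_congr rfl fun x _ => hterm x, Finset.sum_boole, phiZ,
    ← Nat.card_range_of_injective (Units.val_injective (α := Zi ⧸ Ideal.span {π ^ ℓ})),
    Nat.card_coe_set_eq, ← Set.ncard_coe_finset]
  congr 2
  ext x
  simp only [Finset.coe_filter, Finset.mem_univ, true_and, Set.mem_ofPred_eq]
  rfl

include hπ h in
lemma g4_of_le_of_not_dvd {k ℓ : ℕ} (hk : ℓ ≤ k) (h4 : ℓ % 4 ≠ 0) :
    g4 (GaussianInt.toComplex (π ^ k)) (π ^ ℓ) = 0 := by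
  have hℓ : ℓ ≠ 0 := by rintro rfl; exact h4 rfl
  have := finite_quotient (pow_ne_zero ℓ hπ.ne_zero)
  let := Fintype.ofFinite (Zi ⧸ Ideal.span {π ^ ℓ})
  have := finite_quotient hπ.ne_zero
  let := Fintype.ofFinite (Zi ⧸ Ideal.span {π})
  obtain ⟨K, -, hsum⟩ := exists_card_fiber (reduction π hℓ).toAddMonoidHom
    (reduction_surjective π hℓ)
  rw [g4_of_le hπ h hℓ hk]
  refine (hsum fun y => quarticChar hπ h y ^ ℓ).trans ?_
  simp only [← MulChar.pow_apply' _ hℓ]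
  rw [MulChar.sum_eq_zero_of_ne_one (quarticChar_pow_ne_one hπ h h4), mul_zero]

include hπ h in
lemma g4_of_add_two_le {k ℓ : ℕ} (hk : k + 2 ≤ ℓ) :
    g4 (GaussianInt.toComplex (π ^ k)) (π ^ ℓ) = 0 := by
  obtain ⟨n, rfl⟩ := Nat.exists_eq_add_of_le hk
  have hℓ : k + 2 + n ≠ 0 := by omega
  have hc := pow_ne_zero (k + 2 + n) hπ.ne_zero
  have := finite_quotient hc
  let := Fintype.ofFinite (Zi ⧸ Ideal.span {π ^ (k + 2 + n)})
  have hπ' : GaussianInt.toComplex π ≠ 0 := by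
    simpa [GaussianInt.toComplex_eq_zero] using hπ.ne_zero
  obtain ⟨t, ht⟩ := exists_eCheck_ne_one hπ h n.succ_ne_zero
  rw [g4_eq_sum hπ h hℓ]
  refine sum_eq_zero_of_shift _ (Ideal.Quotient.mk _ (π * t)) ht fun x => ?_
  have hred : reduction π hℓ (Ideal.Quotient.mk _ (π * t)) = 0 := by
    rw [reduction_mk, Ideal.Quotient.eq_zero_iff_dvd]
    exact dvd_mul_right π t
  rw [map_add, hred, add_zero, mul_left_comm]
  congr 1
  have hd : π ^ (k + 2 + n) ∣
      π ^ k * Quotient.out (x + Ideal.Quotient.mk (Ideal.span {π ^ (k + 2 + n)}) (π * t)) -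
        (π ^ k * (π * t) + π ^ k * Quotient.out x) := by
    rw [← mul_add, ← mul_sub]
    apply Dvd.dvd.mul_left
    rw [← Ideal.Quotient.eq_zero_iff_dvd, map_sub, map_add, Ideal.Quotient.mk_out,
      Ideal.Quotient.mk_out]
    abel
  rw [← map_mul, eCheck_div_congr hc hd, map_add, add_div, eCheck_add,
    map_mul _ (π ^ k) (Quotient.out x)]
  congr 2
  simp only [map_mul, map_pow]
  rw [show k + 2 + n = k + 1 + (n + 1) by ring, pow_add, pow_succ]
  field_simp

end

/-- local evaluation of quartic Gauss sums at prime powers. -/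
theorem gauss_sum_local (π : Zi) (hπ : Prime π) (hcong : lam ^ 3 ∣ π - 1) (k ℓ : ℕ) :
    g4 (GaussianInt.toComplex (π ^ k)) (π ^ ℓ) =
      if ℓ = 0 then 1
      else if ℓ = k + 1 then
        (if k % 4 = 0 then (Ni π : ℂ) ^ k * g4 1 π
         else if k % 4 = 1 then (Ni π : ℂ) ^ k * g2 1 π
         else if k % 4 = 2 then
           (Ni π : ℂ) ^ k * quarticSym (-1) π * (starRingEnd ℂ) (g4 1 π)
         else -(Ni π : ℂ) ^ k)
      else if ℓ ≤ k ∧ ℓ % 4 = 0 then (phiZ (π ^ ℓ) : ℂ)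
      else 0 := by
  by_cases hℓ : ℓ = 0
  · rw [if_pos hℓ, hℓ]
    exact g4_zero_exponent _ π ⟨_, rfl⟩
  rw [if_neg hℓ]
  by_cases hk : ℓ = k + 1
  · have := finite_quotient hπ.ne_zero
    let := Fintype.ofFinite (Zi ⧸ Ideal.span {π})
    rw [if_pos hk, hk, g4_succ hπ hcong]
    obtain ⟨m, hm⟩ : ∃ m, k = 4 * m + k % 4 := ⟨k / 4, by omega⟩
    have hlt : k % 4 < 4 := Nat.mod_lt _ (by norm_num)
    have hpow : ∀ y, quarticChar hπ hcong y ^ (k + 1) = quarticChar hπ hcong y ^ (k % 4 + 1) := by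
      intro y
      conv_lhs => rw [hm, add_assoc, quarticChar_pow_add_four hπ hcong y (Nat.succ_ne_zero _)]
    simp only [hpow]
    interval_cases hr : k % 4
    · rw [if_pos rfl, g4_one_eq_sum hπ hcong]
      simp only [zero_add, pow_one]
    · rw [if_neg one_ne_zero, if_pos rfl, g2_one_eq_sum hπ hcong]
    · rw [if_neg two_ne_zero, if_neg (by norm_num), if_pos rfl, mul_assoc, conj_g4_one hπ hcong]
    · rw [if_neg (by norm_num), if_neg (by norm_num), if_neg (by norm_num),
        sum_quarticChar_pow_mul_addCharMod hπ hcong (by norm_num) (by norm_num), mul_neg_one]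
  rw [if_neg hk]
  by_cases hle : ℓ ≤ k
  · by_cases h4 : ℓ % 4 = 0
    · rw [if_pos ⟨hle, h4⟩, g4_of_le_of_dvd hπ hcong hℓ hle h4]
    · rw [if_neg fun hc => h4 hc.2, g4_of_le_of_not_dvd hπ hcong hle h4]
  · rw [if_neg fun hc => hle hc.1, g4_of_add_two_le hπ hcong (by omega)]
end
end

section
/- Let π ∈ ℤ[i] be a degree 1 prime with π ≡ 1 (mod λ³) (i.e. N(π) = p for a rational prime p ≡ 1 mod 4). Then the quartic Gauss sum satisfies g₄(1, π)⁴ = π³ · π̄ and g₄(1, π)² = -(-1/π)₄ · (π̄/π)₄^{-2} · N(π)^{1/2} · π. -/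
noncomputable section

open scoped Classical
open Complex

open Polynomial in
/-- The Euler operator `X · d/dX` on polynomials. -/
def eulerOp (R : Type*) [CommRing R] : R[X] →ₗ[R] R[X] :=
  LinearMap.mulLeft R X ∘ₗ derivative

open Polynomial in
lemma eulerOp_apply {R : Type*} [CommRing R] (f : R[X]) :
    eulerOp R f = X * derivative f := rfl

open Polynomial in
lemma eulerOp_pow_X_pow {R : Type*} [CommRing R] (m n : ℕ) :
    (eulerOp R ^ m) (X ^ n) = C ((n : R) ^ m) * X ^ n := by
  induction m with
  | zero => simp
  | succ m ih =>
    rw [pow_succ', Module.End.mul_apply, ih, eulerOp_apply, derivative_C_mul_X_pow]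
    rcases n with _ | n
    · simp
    · simp only [Nat.add_sub_cancel, map_mul, map_pow]
      ring

open Polynomial in
lemma eval_one_eulerOp_pow {R : Type*} [CommRing R] (m : ℕ) (q : R[X]) :
    eval 1 ((eulerOp R ^ m) ((X - 1) ^ m * q)) = m.factorial * eval 1 q := by
  induction m generalizing q with
  | zero => simp
  | succ m ih =>
    have h : eulerOp R ((X - 1) ^ (m + 1) * q) =
        (X - 1) ^ m * (X * ((m + 1 : R[X]) * q + (X - 1) * derivative q)) := by
      have h1 : derivative ((X - 1 : R[X]) ^ (m + 1)) = (m + 1 : R[X]) * (X - 1) ^ m := by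
        rw [derivative_pow]; simp
      rw [eulerOp_apply, derivative_mul, h1]
      ring
    rw [pow_succ, Module.End.mul_apply, h, ih]
    simp [Nat.factorial_succ]
    ring

lemma prod_range_two_mul_reflect {M : Type*} [CommMonoid M] (m : ℕ) (f : ℕ → M) :
    ∏ k ∈ Finset.range (2 * m), f k =
      (∏ k ∈ Finset.range m, f k) * ∏ k ∈ Finset.range m, f (2 * m - 1 - k) := by
  rw [two_mul, Finset.prod_range_add]
  congr 1
  rw [← Finset.prod_range_reflect]
  refine Finset.prod_congr rfl fun k hk => ?_
  have := Finset.mem_range.mp hk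
  congr 1
  omega

lemma factorial_half_sq {p n : ℕ} [Fact p.Prime] (hp : p = 4 * n + 1) :
    (((2 * n).factorial : ℕ) : ZMod p) * ((2 * n).factorial : ℕ) = -1 := by
  have h := ZMod.wilsons_lemma p
  rw [show p - 1 = 2 * (2 * n) by omega, ← Finset.prod_range_add_one_eq_factorial,
    prod_range_two_mul_reflect, Nat.cast_mul, Finset.prod_range_add_one_eq_factorial] at h
  rw [← h]
  congr 1
  rw [← Finset.prod_range_add_one_eq_factorial]
  push_cast
  have : ∀ k ∈ Finset.range (2 * n), (((2 * (2 * n) - 1 - k : ℕ) : ZMod p) + 1) =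
      (-1) * ((k : ZMod p) + 1) := by
    intro k hk
    have hk := Finset.mem_range.mp hk
    have : ((2 * (2 * n) - 1 - k + 1 + (k + 1) : ℕ) : ZMod p) = 0 := by
      rw [show 2 * (2 * n) - 1 - k + 1 + (k + 1) = p by omega]
      simp
    push_cast at this
    linear_combination this
  rw [Finset.prod_congr rfl this, Finset.prod_mul_distrib]
  simp

open Polynomial in
/-- The polynomial whose value at `exp (2πi/p)`, for `p = 2m + 1`, is the product of the numbers
`2 sin (πk/p)` up to sign. -/
def sineProd (R : Type*) [CommRing R] (m : ℕ) : R[X] :=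
  ∏ k ∈ Finset.range m, (X ^ ((m + 1) * (k + 1)) - X ^ (m * (k + 1)))

open Polynomial in
lemma sineProd_eq (R : Type*) [CommRing R] (m : ℕ) :
    sineProd R m = (X - 1) ^ m * ∏ k ∈ Finset.range m,
      (X ^ (m * (k + 1)) * ∑ i ∈ Finset.range (k + 1), X ^ i) := by
  have : ∀ k ∈ Finset.range m, (X ^ ((m + 1) * (k + 1)) - X ^ (m * (k + 1)) : R[X]) =
      (X - 1) * (X ^ (m * (k + 1)) * ∑ i ∈ Finset.range (k + 1), X ^ i) := by
    intro k _
    have := geom_sum_mul (X : R[X]) (k + 1)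
    linear_combination -(X ^ (m * (k + 1)) : R[X]) * this
  rw [sineProd, Finset.prod_congr rfl this, Finset.prod_mul_distrib]
  simp

open Polynomial in
lemma eval_one_eulerOp_pow_sineProd (R : Type*) [CommRing R] (m : ℕ) :
    eval 1 ((eulerOp R ^ m) (sineProd R m)) = m.factorial * m.factorial := by
  rw [sineProd_eq, eval_one_eulerOp_pow]
  congr 1
  rw [← Finset.prod_range_add_one_eq_factorial]
  push_cast
  simp [eval_prod, eval_finsetSum]

open Polynomial in
lemma map_sineProd {R S : Type*} [CommRing R] [CommRing S] (f : R →+* S) (m : ℕ) :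
    (sineProd R m).map f = sineProd S m := by
  simp [sineProd, Polynomial.map_prod]

lemma prod_neg_one_pow_mul_I (n : ℕ) :
    ∏ k ∈ Finset.range (2 * n), ((-1 : ℂ) ^ (k + 1) * I) = 1 := by
  induction n with
  | zero => simp
  | succ n ih =>
    rw [show 2 * (n + 1) = 2 * n + 1 + 1 by ring, Finset.prod_range_succ, Finset.prod_range_succ, ih]
    have : (-1 : ℂ) ^ (2 * n) = 1 := by rw [pow_mul]; simp
    simp only [pow_succ, this]
    linear_combination -I_mul_I

open Polynomial in
lemma eval_sineProd_eq_prod_sin {p n : ℕ} (hp : p = 4 * n + 1) :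
    (sineProd ℂ (2 * n)).eval (exp (2 * Real.pi * I / p)) =
      ((∏ k ∈ Finset.range (2 * n), (2 * Real.sin (Real.pi * (k + 1) / p)) : ℝ) : ℂ) := by
  have hp0 : (p : ℂ) ≠ 0 := by
    have : p ≠ 0 := by omega
    exact_mod_cast this
  have hpn : (p : ℂ) = 4 * n + 1 := by rw [hp]; push_cast; ring
  rw [sineProd, eval_prod, ofReal_prod, ← one_mul (∏ k ∈ _, ((_ : ℝ) : ℂ)),
    ← prod_neg_one_pow_mul_I n, ← Finset.prod_mul_distrib]
  refine Finset.prod_congr rfl fun k _ => ?_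
  simp only [eval_sub, eval_pow, eval_X, ← Complex.exp_nat_mul]
  push_cast
  have h1 : ((2 * n + 1) * (k + 1) : ℂ) * (2 * Real.pi * I / p) =
      (k + 1 : ℕ) * (Real.pi * I) + (Real.pi * (k + 1) / p) * I := by
    push_cast
    field_simp
    rw [hpn]
    ring
  have h2 : ((2 * n) * (k + 1) : ℂ) * (2 * Real.pi * I / p) =
      (k + 1 : ℕ) * (Real.pi * I) + (-(Real.pi * (k + 1) / p)) * I := by
    push_cast
    field_simp
    rw [hpn]
    ring
  rw [h1, h2, Complex.exp_add, Complex.exp_add, Complex.exp_nat_mul, Complex.exp_pi_mul_I,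
    Complex.sin]
  linear_combination -(-1 : ℂ) ^ (k + 1) * (cexp (-(Real.pi * (k + 1) / p) * I) -
    cexp ((Real.pi * (k + 1) / p) * I)) * I_mul_I

open Polynomial in
lemma normSq_eval_sineProd {m : ℕ} {ζ : ℂ} (hζ : IsPrimitiveRoot ζ (2 * m + 1)) :
    ‖(sineProd ℂ m).eval ζ‖ ^ 2 = 2 * m + 1 := by
  have h := congrArg norm hζ.prod_one_sub_pow_eq_order
  have hn : ‖ζ‖ = 1 := hζ.norm'_eq_one (by omega)
  have hr : ‖((2 * m : ℕ) : ℂ) + 1‖ = 2 * m + 1 := by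
    rw [show ((2 * m : ℕ) : ℂ) + 1 = ((2 * m + 1 : ℕ) : ℂ) by push_cast; ring,
      Complex.norm_natCast]
    push_cast
    ring
  rw [hr, norm_prod, prod_range_two_mul_reflect] at h
  rw [← h, sineProd, eval_prod, norm_prod, sq]
  congr 1 <;> refine Finset.prod_congr rfl fun k hk => ?_
  · simp only [eval_sub, eval_pow, eval_X]
    rw [show ζ ^ ((m + 1) * (k + 1)) - ζ ^ (m * (k + 1)) =
      -(ζ ^ (m * (k + 1)) * (1 - ζ ^ (k + 1))) by ring, norm_neg, norm_mul, norm_pow, hn]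
    simp
  · have hk := Finset.mem_range.mp hk
    simp only [eval_sub, eval_pow, eval_X]
    have h1 : ζ ^ (2 * m - 1 - k + 1) * ζ ^ (k + 1) = 1 := by
      rw [← pow_add, show 2 * m - 1 - k + 1 + (k + 1) = 2 * m + 1 by omega, hζ.pow_eq_one]
    have h2 : ζ ^ ((m + 1) * (k + 1)) - ζ ^ (m * (k + 1)) =
        ζ ^ (m * (k + 1)) * ζ ^ (k + 1) * (1 - ζ ^ (2 * m - 1 - k + 1)) := by
      linear_combination (ζ ^ (m * (k + 1))) * h1
    rw [h2, norm_mul, norm_mul, norm_pow, norm_pow, hn]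
    simp

open Polynomial in
lemma eval_sineProd_eq_sqrt {p n : ℕ} (hp : p = 4 * n + 1) :
    (sineProd ℂ (2 * n)).eval (exp (2 * Real.pi * I / p)) = (Real.sqrt p : ℂ) := by
  have hζ : IsPrimitiveRoot (exp (2 * Real.pi * I / p)) (2 * (2 * n) + 1) := by
    rw [show 2 * (2 * n) + 1 = p by omega]
    exact Complex.isPrimitiveRoot_exp p (by omega)
  have h := normSq_eval_sineProd hζ
  rw [eval_sineProd_eq_prod_sin hp] at h ⊢
  congr 1
  symm
  rw [Real.sqrt_eq_iff_mul_self_eq (by positivity)]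
  · rw [Complex.norm_real, Real.norm_eq_abs, sq_abs] at h
    rw [← sq, h, hp]
    push_cast
    ring
  · refine Finset.prod_nonneg fun k hk => mul_nonneg zero_le_two ?_
    have hk := Finset.mem_range.mp hk
    have hp0 : (0 : ℝ) < p := by
      have : 0 < p := by omega
      exact_mod_cast this
    refine Real.sin_nonneg_of_nonneg_of_le_pi (by positivity) ?_
    rw [div_le_iff₀ hp0]
    have : ((k : ℝ) + 1) ≤ p := by
      have : k + 1 ≤ p := by omega
      exact_mod_cast this
    exact mul_le_mul_of_nonneg_left this Real.pi_pos.le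

open Polynomial in
/-- The sign of the quadratic Gauss sum for primes `p ≡ 1 (mod 4)`. -/
theorem gaussSum_quadraticChar_stdAddChar {p : ℕ} [Fact p.Prime] (hp : p % 4 = 1) :
    gaussSum ((quadraticChar (ZMod p)).ringHomComp (Int.castRingHom ℂ)) ZMod.stdAddChar =
      (Real.sqrt p : ℂ) := by
  obtain ⟨n, hn⟩ : ∃ n, p = 4 * n + 1 := ⟨p / 4, by omega⟩
  have hpp : p.Prime := Fact.out
  have hchar : ringChar (ZMod p) ≠ 2 := by rw [ZMod.ringChar_zmod_n]; rintro rfl; omega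
  set ζ : ℂ := exp (2 * Real.pi * I / p) with hζ
  have hprim : IsPrimitiveRoot ζ p := Complex.isPrimitiveRoot_exp p hpp.ne_zero
  set g := gaussSum ((quadraticChar (ZMod p)).ringHomComp (Int.castRingHom ℂ)) ZMod.stdAddChar
    with hg
  have hsq : g ^ 2 = p := by
    rw [hg, gaussSum_sq ((MulChar.ringHomComp_ne_one_iff (Int.cast_injective)).mpr
      (quadraticChar_ne_one hchar)) ((quadraticChar_isQuadratic _).comp _)
      (ZMod.isPrimitive_stdAddChar p)]
    have : quadraticChar (ZMod p) (-1) = 1 := by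
      rw [quadraticChar_neg_one hchar, ZMod.card, ZMod.χ₄_nat_one_mod_four hp]
    simp [MulChar.ringHomComp_apply, this]
  have hS := eval_sineProd_eq_sqrt hn
  have hsqrt : ((Real.sqrt p : ℝ) : ℂ) ^ 2 = p := by
    rw [← ofReal_pow, Real.sq_sqrt (by positivity)]
    simp
  obtain ⟨ε, hε, hgε⟩ : ∃ ε : ℤ, (ε = 1 ∨ ε = -1) ∧ g = ε * (Real.sqrt p : ℂ) := by
    rcases sq_eq_sq_iff_eq_or_eq_neg.mp (hsq.trans hsqrt.symm) with h | h
    · exact ⟨1, Or.inl rfl, by simpa using h⟩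
    · exact ⟨-1, Or.inr rfl, by simpa using h⟩
  set f : ℤ[X] := (∑ x : ZMod p, C (quadraticChar (ZMod p) x) * X ^ x.val) -
    C ε * sineProd ℤ (2 * n) with hf
  have hroot : aeval ζ f = 0 := by
    have h1 : aeval ζ (sineProd ℤ (2 * n)) = (Real.sqrt p : ℂ) := by
      rw [← hS, ← map_sineProd (algebraMap ℤ ℂ), eval_map_algebraMap]
    rw [hf, map_sub, map_mul, h1, map_sum, sub_eq_zero]
    simp only [map_mul, map_pow, aeval_X, aeval_C]
    rw [eq_intCast, ← hgε, hg, gaussSum]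
    refine Finset.sum_congr rfl fun x _ => ?_
    rw [MulChar.ringHomComp_apply]
    congr 1
    rw [ZMod.stdAddChar_apply, ZMod.toCircle_apply, hζ, ← Complex.exp_nat_mul]
    congr 1
    ring
  have hdvd : cyclotomic p ℤ ∣ f := by
    rw [cyclotomic_eq_minpoly hprim hpp.pos]
    exact minpoly.isIntegrallyClosed_dvd (hprim.isIntegral hpp.pos) hroot
  have hdvd' : (X - 1) ^ (p - 1) ∣ f.map (Int.castRingHom (ZMod p)) := by
    have h := Polynomial.map_dvd (Int.castRingHom (ZMod p)) hdvd
    have h1 := cyclotomic_mul_prime_eq_pow_of_not_dvd (ZMod p) (n := 1) (p := p)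
      hpp.not_dvd_one
    rw [one_mul, cyclotomic_one] at h1
    rwa [map_cyclotomic, h1] at h
  obtain ⟨w, hw⟩ := hdvd'
  have hzero : eval 1 ((eulerOp (ZMod p) ^ (2 * n)) (f.map (Int.castRingHom (ZMod p)))) = 0 := by
    rw [hw, show p - 1 = 2 * n + 2 * n by omega, pow_add, mul_assoc, eval_one_eulerOp_pow]
    have : n ≠ 0 := by rintro rfl; exact hpp.one_lt.ne' hn
    simp [this]
  have hfmap : f.map (Int.castRingHom (ZMod p)) =
      (∑ x : ZMod p, (x ^ (2 * n)) • X ^ x.val) - (ε : ZMod p) • sineProd (ZMod p) (2 * n) := by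
    rw [hf, Polynomial.map_sub, Polynomial.map_mul, map_sineProd, Polynomial.map_sum]
    congr 1
    · refine Finset.sum_congr rfl fun x _ => ?_
      have := quadraticChar_eq_pow_of_char_ne_two' hchar x
      rw [ZMod.card, show p / 2 = 2 * n by omega] at this
      simp [smul_eq_C_mul, ← this]
    · simp [smul_eq_C_mul]
  have hsum : ∑ x : ZMod p, x ^ (2 * n) * x ^ (2 * n) = -1 := by
    have hx : ∀ x : ZMod p, x ^ (2 * n) * x ^ (2 * n) = if x = 0 then 0 else 1 := by
      intro x
      have hn0 : n ≠ 0 := by rintro rfl; exact hpp.one_lt.ne' hn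
      rw [← pow_add, show 2 * n + 2 * n = p - 1 by omega]
      split_ifs with h
      · rw [h, zero_pow (by omega)]
      · exact ZMod.pow_card_sub_one_eq_one h
    simp only [hx]
    have : ∀ x : ZMod p, (if x = 0 then (0 : ZMod p) else 1) = 1 - if x = 0 then 1 else 0 := by
      intro x; split_ifs <;> simp
    simp [this]
  rw [hfmap, map_sub, map_sum, eval_sub, eval_finsetSum, map_smul, eval_smul,
    eval_one_eulerOp_pow_sineProd, factorial_half_sq hn] at hzero
  simp only [map_smul, eulerOp_pow_X_pow, eval_smul, eval_mul, eval_C, eval_pow, eval_X, one_pow,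
    mul_one, ZMod.natCast_zmod_val, smul_eq_mul, hsum] at hzero
  rcases hε with rfl | rfl
  · simpa using hgε
  · exfalso
    have h2 : ((2 : ℕ) : ZMod p) = 0 := by
      push_cast at hzero ⊢
      linear_combination -hzero
    rw [ZMod.natCast_eq_zero_iff] at h2
    have := Nat.le_of_dvd two_pos h2
    have := hpp.one_lt
    omega

/-- The imaginary unit of `ℤ[i]`. -/
def gaussI : Zi := ⟨0, 1⟩

lemma gaussI_mul_self : gaussI * gaussI = -1 := by
  ext <;> simp [gaussI]

lemma eq_of_pow_four_eq_one {R : Type*} [CommRing R] [IsDomain R] {t y : R} (ht : t * t = -1)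
    (hy : y ^ 4 = 1) : y = 1 ∨ y = -1 ∨ y = t ∨ y = -t := by
  have h : (y - 1) * ((y + 1) * ((y - t) * (y + t))) = 0 := by
    linear_combination hy - (y ^ 2 - 1) * ht
  rcases mul_eq_zero.mp h with h | h
  · exact Or.inl (sub_eq_zero.mp h)
  rcases mul_eq_zero.mp h with h | h
  · exact Or.inr (Or.inl (eq_neg_of_add_eq_zero_left h))
  rcases mul_eq_zero.mp h with h | h
  · exact Or.inr (Or.inr (Or.inl (sub_eq_zero.mp h)))
  · exact Or.inr (Or.inr (Or.inr (eq_neg_of_add_eq_zero_left h)))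

/-- Reduction of `ℤ[i]` modulo a degree one prime. -/
lemma exists_residue_hom {π : Zi} (hπ : Prime π) {p : ℕ} [Fact p.Prime] (hdeg : Ni π = (p : ℤ)) :
    ∃ r : Zi →+* ZMod p, ∀ x, r x = 0 ↔ π ∣ x := by
  have hpp : p.Prime := Fact.out
  have hab : π.re * π.re + π.im * π.im = p := by
    rw [← hdeg, Ni, Zsqrtd.norm_def]; ring
  have hab' : (π.re : ZMod p) * π.re + π.im * π.im = 0 := by
    have := congrArg (Int.cast : ℤ → ZMod p) hab
    simpa using this
  have hb : (π.im : ZMod p) ≠ 0 := by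
    intro hb
    rw [hb, mul_zero, add_zero, mul_self_eq_zero] at hab'
    rw [ZMod.intCast_zmod_eq_zero_iff_dvd] at hb hab'
    obtain ⟨c, hc⟩ := hb
    obtain ⟨d, hd⟩ := hab'
    rw [hc, hd] at hab
    have hp0 : (p : ℤ) ≠ 0 := by exact_mod_cast hpp.ne_zero
    have h1 : (p : ℤ) * (d * d + c * c) = 1 := by
      apply mul_left_cancel₀ hp0
      linear_combination hab
    have := Int.isUnit_iff.mp (IsUnit.of_mul_eq_one _ h1)
    have := hpp.one_lt
    omega
  set t : ZMod p := -π.re / π.im with ht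
  have htt : t * t = ((-1 : ℤ) : ZMod p) := by
    rw [ht]
    push_cast
    field_simp
    linear_combination hab'
  refine ⟨Zsqrtd.lift ⟨t, htt⟩, fun x => ?_⟩
  have hrπ : Zsqrtd.lift ⟨t, htt⟩ π = 0 := by
    have hπt : (π.re : ZMod p) + π.im * t = 0 := by
      rw [ht]
      field_simp
      ring
    rw [Zsqrtd.lift_apply_apply]
    exact hπt
  constructor
  · intro hx
    by_contra hdvd
    obtain ⟨u, v, huv⟩ := hπ.irreducible.coprime_iff_not_dvd.mpr hdvd
    have := congrArg (Zsqrtd.lift ⟨t, htt⟩) huv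
    rw [map_add, map_mul, map_mul, hrπ, hx, mul_zero, mul_zero, add_zero, map_one] at this
    exact zero_ne_one this
  · rintro ⟨c, rfl⟩
    rw [map_mul, hrπ, zero_mul]

section Residue

variable {p : ℕ} [Fact p.Prime]

lemma two_ne_zero_of_mod_four (hmod : p % 4 = 1) : (2 : ZMod p) ≠ 0 := by
  intro h
  have h2 : ((2 : ℕ) : ZMod p) = 0 := by exact_mod_cast h
  rw [ZMod.natCast_eq_zero_iff] at h2
  have := Nat.le_of_dvd two_pos h2
  have : p.Prime := Fact.out
  have := this.one_lt
  omega

lemma residue_injOn_units (hmod : p % 4 = 1) (r : Zi →+* ZMod p) {u v : Zi} (hu : u ^ 4 = 1)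
    (hv : v ^ 4 = 1) (h : r u = r v) : u = v := by
  have h2 := two_ne_zero_of_mod_four hmod
  have hw : r (u * v ^ 3) = 1 := by
    rw [map_mul, h, ← map_mul, show v * v ^ 3 = v ^ 4 by ring, hv, map_one]
  have htt : r gaussI * r gaussI = -1 := by rw [← map_mul, gaussI_mul_self, map_neg, map_one]
  have hone : u * v ^ 3 = 1 := by
    have hw4 : (u * v ^ 3) ^ 4 = 1 := by
      rw [mul_pow, ← pow_mul, mul_comm 3 4, pow_mul, hu, hv]; simp
    rcases eq_of_pow_four_eq_one gaussI_mul_self hw4 with h | h | h | h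
    · exact h
    all_goals
      exfalso
      apply h2
      rw [h] at hw
      try rw [map_neg] at hw
      try rw [map_one] at hw
    · linear_combination -hw
    · linear_combination htt - (r gaussI + 1) * hw
    · linear_combination htt - (1 - r gaussI) * hw
  linear_combination v * hone - u * hv

lemma exists_unit_lift (r : Zi →+* ZMod p) {y : ZMod p} (hy : y ^ 4 = 1) :
    ∃ u : Zi, u ^ 4 = 1 ∧ r u = y := by
  have htt : r gaussI * r gaussI = -1 := by rw [← map_mul, gaussI_mul_self, map_neg, map_one]
  have hi : gaussI ^ 4 = 1 := by
    linear_combination (gaussI ^ 2 - 1) * gaussI_mul_self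
  rcases eq_of_pow_four_eq_one htt hy with h | h | h | h
  · exact ⟨1, by ring, by rw [h, map_one]⟩
  · exact ⟨-1, by ring, by rw [h, map_neg, map_one]⟩
  · exact ⟨gaussI, hi, h.symm⟩
  · exact ⟨-gaussI, by rw [neg_pow, hi]; ring, by rw [map_neg, h]⟩

/-- The quartic residue character attached to a reduction map `ℤ[i] → 𝔽_p`. -/
lemma exists_quarticChar (hmod : p % 4 = 1) (r : Zi →+* ZMod p) :
    ∃ χ : MulChar (ZMod p) Zi, ∀ x ≠ 0, χ x ^ 4 = 1 ∧ r (χ x) = x ^ (p / 4) := by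
  have hex : ∀ x : (ZMod p)ˣ, ∃ u : Zi, u ^ 4 = 1 ∧ r u = (x : ZMod p) ^ (p / 4) := fun x => by
    apply exists_unit_lift
    rw [← pow_mul, show p / 4 * 4 = p - 1 by omega]
    exact ZMod.pow_card_sub_one_eq_one x.ne_zero
  choose q hq4 hqr using hex
  let f : (ZMod p)ˣ →* Zi :=
    { toFun := q
      map_one' := residue_injOn_units hmod r (hq4 1) (one_pow 4) (by rw [hqr]; simp)
      map_mul' := fun x y => residue_injOn_units hmod r (hq4 _)
        (by rw [mul_pow, hq4, hq4, one_mul]) (by rw [hqr, map_mul, hqr, hqr]; simp [mul_pow]) }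
  refine ⟨MulChar.ofUnitHom f.toHomUnits, fun x hx => ?_⟩
  have : MulChar.ofUnitHom f.toHomUnits x = q (Units.mk0 x hx) :=
    MulChar.ofUnitHom_coe f.toHomUnits (Units.mk0 x hx)
  rw [this]
  exact ⟨hq4 _, by rw [hqr]; rfl⟩

lemma quarticSym_eq_of_residue {π : Zi} (hπ : Prime π) (hdeg : Ni π = (p : ℤ)) (hmod : p % 4 = 1)
    {r : Zi →+* ZMod p} (hr : ∀ x, r x = 0 ↔ π ∣ x) {χ : MulChar (ZMod p) Zi}
    (hχ : ∀ x ≠ 0, χ x ^ 4 = 1 ∧ r (χ x) = x ^ (p / 4)) (α : Zi) :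
    quarticSym α π = GaussianInt.toComplex (χ (r α)) := by
  rw [quarticSym]
  by_cases hα : r α = 0
  · rw [if_neg, hα, MulChar.map_zero, map_zero]
    rw [isCoprime_comm, hπ.irreducible.coprime_iff_not_dvd, not_not]
    exact (hr α).mp hα
  · have hcop : IsCoprime α π := by
      rw [isCoprime_comm, hπ.irreducible.coprime_iff_not_dvd]
      exact fun h => hα ((hr α).mpr h)
    obtain ⟨π', hassoc, hfac⟩ := prime_factors_irreducible hπ.irreducible
      ⟨UniqueFactorizationMonoid.prime_of_factor, UniqueFactorizationMonoid.factors_prod hπ.ne_zero⟩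
    rw [if_pos hcop, hfac, Multiset.map_singleton, Multiset.prod_singleton]
    congr 1
    have hN : Ni π' = p := by
      rw [← hdeg]
      exact (Zsqrtd.norm_eq_of_associated (by norm_num) hassoc).symm
    have hexp : ((Ni π' - 1) / 4).toNat = p / 4 := by
      rw [hN]; omega
    have key : ∀ u : Zi, π' ∣ α ^ ((Ni π' - 1) / 4).toNat - u ↔ r u = r α ^ (p / 4) := fun u => by
      rw [hexp, ← hassoc.dvd_iff_dvd_left, ← hr, map_sub, map_pow, sub_eq_zero, eq_comm]
    have hex : ∃ u : Zi, u ^ 4 = 1 ∧ π' ∣ α ^ ((Ni π' - 1) / 4).toNat - u :=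
      ⟨χ (r α), (hχ _ hα).1, (key _).mpr (hχ _ hα).2⟩
    rw [quarticPrime, dif_pos hex]
    refine residue_injOn_units hmod r hex.choose_spec.1 (hχ _ hα).1 ?_
    rw [(key _).mp hex.choose_spec.2, (hχ _ hα).2]

lemma residue_two_re {π : Zi} {r : Zi →+* ZMod p} (hr : ∀ x, r x = 0 ↔ π ∣ x) :
    r (star π) = ((2 * π.re : ℤ) : ZMod p) := by
  have h : star π = ((2 * π.re : ℤ) : Zi) - π := by
    ext
    · simp; ring
    · simp
  rw [h, map_sub, (hr π).mpr dvd_rfl, sub_zero, map_intCast]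

lemma eCheck_div_eq_stdAddChar {π : Zi} (hπ : Prime π) (hdeg : Ni π = (p : ℤ))
    {r : Zi →+* ZMod p} (hr : ∀ x, r x = 0 ↔ π ∣ x) (d : Zi) :
    eCheck (1 * GaussianInt.toComplex d / GaussianInt.toComplex π) =
      ZMod.stdAddChar (r (star π) * r d) := by
  have hpp : p.Prime := Fact.out
  have hp0 : (p : ℂ) ≠ 0 := by exact_mod_cast hpp.ne_zero
  have hπ0 : GaussianInt.toComplex π ≠ 0 := by
    simpa using hπ.ne_zero
  have hnorm : GaussianInt.toComplex π * (starRingEnd ℂ) (GaussianInt.toComplex π) = p := by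
    rw [Complex.mul_conj, ← GaussianInt.intCast_complex_norm]
    have : Zsqrtd.norm π = p := hdeg
    rw [this]; simp
  have hπ1 : (starRingEnd ℂ) (GaussianInt.toComplex π) ≠ 0 := by
    simpa using hπ.ne_zero
  have hre : GaussianInt.toComplex π + (starRingEnd ℂ) (GaussianInt.toComplex π) =
      2 * (π.re : ℂ) := by
    rw [Complex.add_conj, ← GaussianInt.intCast_re]
    push_cast
    rfl
  set j : ℤ := ((r d).val : ℤ) with hj
  have hrj : ((j : ℤ) : ZMod p) = r d := by rw [hj]; simp
  obtain ⟨z, hz⟩ : π ∣ d - (j : Zi) := by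
    rw [← hr, map_sub, map_intCast, hrj, sub_self]
  have hd : GaussianInt.toComplex d = j + GaussianInt.toComplex π * GaussianInt.toComplex z := by
    rw [← map_mul, ← hz]; simp
  have hzre : GaussianInt.toComplex z + (starRingEnd ℂ) (GaussianInt.toComplex z) =
      ((2 * z.re : ℤ) : ℂ) := by
    rw [Complex.add_conj, ← GaussianInt.intCast_re]
    push_cast
    rfl
  rw [residue_two_re hr, ← hrj, ← Int.cast_mul, ZMod.stdAddChar_coe, eCheck,
    Complex.exp_eq_exp_iff_exists_int]
  refine ⟨2 * z.re, ?_⟩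
  rw [hd, one_mul, map_div₀, map_add, map_mul, map_intCast]
  have h1 : ((j : ℂ) + GaussianInt.toComplex π * GaussianInt.toComplex z) / GaussianInt.toComplex π
      = j * (starRingEnd ℂ) (GaussianInt.toComplex π) / p + GaussianInt.toComplex z := by
    rw [← hnorm]; field_simp
  have h2 : ((j : ℂ) + (starRingEnd ℂ) (GaussianInt.toComplex π) *
      (starRingEnd ℂ) (GaussianInt.toComplex z)) / (starRingEnd ℂ) (GaussianInt.toComplex π)
      = j * GaussianInt.toComplex π / p + (starRingEnd ℂ) (GaussianInt.toComplex z) := by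
    rw [← hnorm]; field_simp
  rw [h1, h2]
  push_cast at hzre ⊢
  linear_combination (2 * Real.pi * I) * hzre + (2 * Real.pi * I) * (j / p) * hre

lemma g4_one_eq_gaussSum {π : Zi} (hπ : Prime π) (hdeg : Ni π = (p : ℤ)) (hmod : p % 4 = 1)
    {r : Zi →+* ZMod p} (hr : ∀ x, r x = 0 ↔ π ∣ x) {χ : MulChar (ZMod p) Zi}
    (hχ : ∀ x ≠ 0, χ x ^ 4 = 1 ∧ r (χ x) = x ^ (p / 4)) :
    g4 1 π = gaussSum (χ.ringHomComp GaussianInt.toComplex)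
      (ZMod.stdAddChar.mulShift (r (star π))) := by
  have hmk : ∀ x y : Zi, Ideal.Quotient.mk (Ideal.span {π}) x = Ideal.Quotient.mk _ y ↔
      r x = r y := fun x y => by
    rw [Ideal.Quotient.mk_eq_mk_iff_sub_mem, Ideal.mem_span_singleton, ← hr, map_sub, sub_eq_zero]
  have hout : ∀ x : Zi ⧸ Ideal.span {π}, Ideal.Quotient.mk (Ideal.span {π}) x.out = x :=
    fun x => Quotient.out_eq x
  rw [g4, gaussSum, ← finsum_eq_sum_of_fintype]
  refine finsum_eq_of_bijective (fun x => r x.out) ⟨fun x y hxy => ?_, fun y => ?_⟩ fun x => ?_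
  · rw [← hout x, ← hout y]
    exact (hmk _ _).mpr hxy
  · refine ⟨Ideal.Quotient.mk _ ((y.val : ℕ) : Zi), ?_⟩
    refine ((hmk _ _).mp (hout _)).trans ?_
    simp
  · rw [quarticSym_eq_of_residue hπ hdeg hmod hr hχ, eCheck_div_eq_stdAddChar hπ hdeg hr,
      MulChar.ringHomComp_apply, AddChar.mulShift_apply]

open Polynomial in
lemma sum_eval_eq_zero_of_natDegree_lt (f : (ZMod p)[X]) (hf : f.natDegree < p - 1) :
    ∑ x : ZMod p, f.eval x = 0 := by
  simp_rw [eval_eq_sum_range]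
  rw [Finset.sum_comm]
  refine Finset.sum_eq_zero fun i hi => ?_
  have hi := Finset.mem_range.mp hi
  rw [← Finset.mul_sum, FiniteField.sum_pow_lt_card_sub_one, mul_zero]
  rw [ZMod.card]; omega

lemma quarticChar_sq_eq (hmod : p % 4 = 1) {r : Zi →+* ZMod p} {χ : MulChar (ZMod p) Zi}
    (hχ : ∀ x ≠ 0, χ x ^ 4 = 1 ∧ r (χ x) = x ^ (p / 4)) :
    χ * χ = (quadraticChar (ZMod p)).ringHomComp (Int.castRingHom Zi) := by
  refine MulChar.ext fun x => ?_
  rw [MulChar.mul_apply, MulChar.ringHomComp_apply, eq_intCast]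
  have hx := x.ne_zero
  have hchar : ringChar (ZMod p) ≠ 2 := by rw [ZMod.ringChar_zmod_n]; rintro rfl; omega
  refine residue_injOn_units hmod r ?_ ?_ ?_
  · rw [mul_pow, (hχ _ hx).1, one_mul]
  · rw [← Int.cast_pow, show 4 = 2 * 2 by norm_num, pow_mul, quadraticChar_sq_one hx]
    simp
  · rw [map_mul, (hχ _ hx).2, map_intCast, quadraticChar_eq_pow_of_char_ne_two' hchar, ← pow_add,
      ZMod.card]
    congr 1
    omega

lemma lam_dvd_sub_one_of_pow_four {u : Zi} (hu : u ^ 4 = 1) : lam ∣ u - 1 := by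
  rcases eq_of_pow_four_eq_one gaussI_mul_self hu with rfl | rfl | rfl | rfl
  · simp
  · exact ⟨⟨-1, 1⟩, by ext <;> simp [lam]⟩
  · exact ⟨⟨0, 1⟩, by ext <;> simp [lam, gaussI]⟩
  · exact ⟨⟨-1, 0⟩, by ext <;> simp [lam, gaussI]⟩

lemma eq_neg_one_of_lam_cube_dvd {w : Zi} (hw : Zsqrtd.norm w = 1) (h : lam ^ 3 ∣ w + 1) :
    w = -1 := by
  obtain ⟨c, hc⟩ := h
  have hN := congrArg Zsqrtd.norm hc
  rw [Zsqrtd.norm_mul, show Zsqrtd.norm (lam ^ 3) = 8 by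
    simp [lam, pow_succ, Zsqrtd.norm_def]] at hN
  rw [Zsqrtd.norm_def] at hw hN
  simp only [Zsqrtd.re_add, Zsqrtd.im_add, Zsqrtd.re_one, Zsqrtd.im_one] at hN
  have h1 : w.re ≤ 1 := by nlinarith [mul_self_nonneg w.im]
  have h2 : -1 ≤ w.re := by nlinarith [mul_self_nonneg w.im]
  have h3 : 2 * w.re + 2 = 8 * Zsqrtd.norm c := by
    linear_combination hN - hw
  have hre : w.re = -1 := by omega
  have him : w.im = 0 := by
    rw [hre] at hw
    have : w.im * w.im = 0 := by linarith
    exact mul_self_eq_zero.mp this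
  ext
  · simpa using hre
  · simpa using him

lemma quarticChar_ne_one (hmod : p % 4 = 1) {r : Zi →+* ZMod p} {χ : MulChar (ZMod p) Zi}
    (hχ : ∀ x ≠ 0, χ x ^ 4 = 1 ∧ r (χ x) = x ^ (p / 4)) : χ ≠ 1 ∧ χ * χ ≠ 1 ∧
      χ * (χ * χ) = χ⁻¹ := by
  have hchar : ringChar (ZMod p) ≠ 2 := by rw [ZMod.ringChar_zmod_n]; rintro rfl; omega
  have h2 : χ * χ ≠ 1 := by
    rw [quarticChar_sq_eq hmod hχ]
    exact (MulChar.ringHomComp_ne_one_iff Int.cast_injective).mpr (quadraticChar_ne_one hchar)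
  refine ⟨fun h => h2 (by rw [h, one_mul]), h2, ?_⟩
  rw [eq_inv_iff_mul_eq_one]
  refine MulChar.ext fun x => ?_
  have := (hχ _ x.ne_zero).1
  simp only [MulChar.mul_apply, MulChar.one_apply_coe]
  linear_combination this

lemma norm_jacobiSum_quarticChar (hmod : p % 4 = 1) {r : Zi →+* ZMod p} {χ : MulChar (ZMod p) Zi}
    (hχ : ∀ x ≠ 0, χ x ^ 4 = 1 ∧ r (χ x) = x ^ (p / 4)) :
    Zsqrtd.norm (jacobiSum χ (χ * χ)) = p := by
  obtain ⟨h1, h2, h3⟩ := quarticChar_ne_one hmod hχ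
  have hinj := GaussianInt.toComplex_injective
  have hne := fun {φ : MulChar (ZMod p) Zi} =>
    MulChar.ringHomComp_ne_one_iff (χ := φ) (f := GaussianInt.toComplex) hinj
  have hpp : p.Prime := Fact.out
  have hJ := jacobiSum_mul_jacobiSum_inv (F := ZMod p) (F' := ℂ)
    (by rw [ZMod.ringChar_zmod_n, ringChar.eq_zero]; exact hpp.ne_zero.symm)
    (hne.mpr h1) (hne.mpr h2) (by
      rw [← MulChar.ringHomComp_mul, h3]
      exact hne.mpr (inv_ne_one.mpr h1))
  have hstar : jacobiSum (χ.ringHomComp GaussianInt.toComplex)⁻¹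
      ((χ * χ).ringHomComp GaussianInt.toComplex)⁻¹ =
      (starRingEnd ℂ) (GaussianInt.toComplex (jacobiSum χ (χ * χ))) := by
    rw [← jacobiSum_ringHomComp, jacobiSum, jacobiSum, map_sum]
    refine Finset.sum_congr rfl fun x _ => ?_
    rw [map_mul, starRingEnd_apply, starRingEnd_apply, MulChar.star_apply', MulChar.star_apply']
  rw [hstar, jacobiSum_ringHomComp, Complex.mul_conj, ← GaussianInt.intCast_complex_norm,
    ZMod.card] at hJ
  exact_mod_cast hJ

lemma lam_cube_dvd_jacobiSum_add_one (hmod : p % 4 = 1) {r : Zi →+* ZMod p}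
    {χ : MulChar (ZMod p) Zi} (hχ : ∀ x ≠ 0, χ x ^ 4 = 1 ∧ r (χ x) = x ^ (p / 4)) :
    lam ^ 3 ∣ jacobiSum χ (χ * χ) + 1 := by
  obtain ⟨h1, h2, -⟩ := quarticChar_ne_one hmod hχ
  have hlam : lam ^ 3 ∣ lam * 2 := ⟨⟨0, -1⟩, by ext <;> simp [lam, pow_succ]⟩
  have hsum : ∑ x : ZMod p, (χ x - 1) * ((χ * χ) (1 - x) - 1) = jacobiSum χ (χ * χ) + p := by
    have hterm : ∀ x : ZMod p, (χ x - 1) * ((χ * χ) (1 - x) - 1) =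
        χ x * (χ * χ) (1 - x) - χ x - (χ * χ) (1 - x) + 1 := fun x => by ring
    have hs : ∑ x : ZMod p, (χ * χ) (1 - x) = 0 := by
      rw [← MulChar.sum_eq_zero_of_ne_one h2]
      exact (Equiv.subLeft (1 : ZMod p)).sum_comp (χ * χ)
    simp_rw [hterm]
    rw [Finset.sum_add_distrib, Finset.sum_sub_distrib, Finset.sum_sub_distrib,
      MulChar.sum_eq_zero_of_ne_one h1, hs, jacobiSum]
    simp
  have hdvd : lam ^ 3 ∣ jacobiSum χ (χ * χ) + p := by
    rw [← hsum]
    refine Finset.dvd_sum fun x _ => ?_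
    rcases eq_or_ne x 0 with rfl | hx
    · simp
    rcases eq_or_ne x 1 with rfl | hx1
    · simp
    have hx1' : 1 - x ≠ 0 := sub_ne_zero.mpr hx1.symm
    refine hlam.trans (mul_dvd_mul (lam_dvd_sub_one_of_pow_four (hχ x hx).1) ?_)
    rw [quarticChar_sq_eq hmod hχ, MulChar.ringHomComp_apply]
    rcases quadraticChar_dichotomy hx1' with h | h
    · simp [h]
    · rw [h]
      exact ⟨-1, by ext <;> simp⟩
  have hp4 : lam ^ 3 ∣ ((p : Zi) - 1) := by
    obtain ⟨n, hn⟩ : ∃ n, p = 4 * n + 1 := ⟨p / 4, by omega⟩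
    have h4 : lam ^ 3 ∣ 4 := ⟨⟨-1, -1⟩, by ext <;> simp [lam, pow_succ]⟩
    refine h4.trans ⟨n, ?_⟩
    rw [hn]; push_cast; ring
  have := dvd_sub hdvd hp4
  rwa [show jacobiSum χ (χ * χ) + (p : Zi) - ((p : Zi) - 1) = jacobiSum χ (χ * χ) + 1 by ring]
    at this

open Polynomial in
lemma residue_jacobiSum_eq_zero (hmod : p % 4 = 1) {r : Zi →+* ZMod p} {χ : MulChar (ZMod p) Zi}
    (hχ : ∀ x ≠ 0, χ x ^ 4 = 1 ∧ r (χ x) = x ^ (p / 4)) :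
    r (jacobiSum χ (χ * χ)) = 0 := by
  have hpp : p.Prime := Fact.out
  have hp1 := hpp.one_lt
  have hn : p / 4 ≠ 0 := by omega
  have hχ' : ∀ x, r (χ x) = x ^ (p / 4) := fun x => by
    rcases eq_or_ne x 0 with rfl | hx
    · rw [MulChar.map_zero, map_zero, zero_pow hn]
    · exact (hχ x hx).2
  have h := sum_eval_eq_zero_of_natDegree_lt (p := p)
    (X ^ (p / 4) * ((1 - X) ^ (p / 4) * (1 - X) ^ (p / 4))) (by
      have h1 : (1 - X : (ZMod p)[X]).natDegree ≤ 1 := by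
        compute_degree
      have h2 := natDegree_pow_le_of_le (p / 4) h1
      have h3 := natDegree_mul_le_of_le (natDegree_X_pow_le (R := ZMod p) (p / 4))
        (natDegree_mul_le_of_le h2 h2)
      omega)
  rw [jacobiSum, map_sum, ← h]
  refine Finset.sum_congr rfl fun x _ => ?_
  simp [MulChar.mul_apply, hχ']

lemma jacobiSum_quarticChar_eq {π : Zi} (hdeg : Ni π = (p : ℤ)) (hcong : lam ^ 3 ∣ π - 1)
    (hmod : p % 4 = 1) {r : Zi →+* ZMod p} (hr : ∀ x, r x = 0 ↔ π ∣ x) {χ : MulChar (ZMod p) Zi}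
    (hχ : ∀ x ≠ 0, χ x ^ 4 = 1 ∧ r (χ x) = x ^ (p / 4)) :
    jacobiSum χ (χ * χ) = -π := by
  have hpp : p.Prime := Fact.out
  obtain ⟨w, hw⟩ := (hr _).mp (residue_jacobiSum_eq_zero hmod hχ)
  have hN := norm_jacobiSum_quarticChar hmod hχ
  have hL := lam_cube_dvd_jacobiSum_add_one hmod hχ
  have hπN : Zsqrtd.norm π = p := hdeg
  rw [hw, Zsqrtd.norm_mul, hπN] at hN
  have hw1 : Zsqrtd.norm w = 1 := by
    have hp0 : (p : ℤ) ≠ 0 := by exact_mod_cast hpp.ne_zero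
    exact mul_left_cancel₀ hp0 (by rw [hN, mul_one])
  have hL' : lam ^ 3 ∣ w + 1 := by
    rw [hw] at hL
    have := dvd_sub hL (hcong.mul_right w)
    rwa [show π * w + 1 - (π - 1) * w = w + 1 by ring] at this
  rw [hw, eq_neg_one_of_lam_cube_dvd hw1 hL', mul_neg_one]

/-- The square of a quartic Gauss sum for the additive character `x ↦ e(cx/p)`. -/
lemma gaussSum_quarticChar_sq {π : Zi} (hdeg : Ni π = (p : ℤ)) (hcong : lam ^ 3 ∣ π - 1)
    (hmod : p % 4 = 1) {r : Zi →+* ZMod p} (hr : ∀ x, r x = 0 ↔ π ∣ x) {χ : MulChar (ZMod p) Zi}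
    (hχ : ∀ x ≠ 0, χ x ^ 4 = 1 ∧ r (χ x) = x ^ (p / 4)) {c : ZMod p} (hc : c ≠ 0) :
    gaussSum (χ.ringHomComp GaussianInt.toComplex) (ZMod.stdAddChar.mulShift c) ^ 2 =
      -GaussianInt.toComplex (χ (-1)) * GaussianInt.toComplex (χ c) ^ 2 *
        (Real.sqrt p : ℂ) * GaussianInt.toComplex π := by
  obtain ⟨h1, h2, h3⟩ := quarticChar_ne_one hmod hχ
  have hpp : p.Prime := Fact.out
  have hp0 : (p : ℂ) ≠ 0 := by exact_mod_cast hpp.ne_zero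
  have hne := fun {φ : MulChar (ZMod p) Zi} =>
    MulChar.ringHomComp_ne_one_iff (χ := φ) (f := GaussianInt.toComplex)
      GaussianInt.toComplex_injective
  set ψ := (ZMod.stdAddChar (N := p)).mulShift c with hψ
  have hprim : ψ.IsPrimitive := fun a ha => by
    rw [hψ, AddChar.mulShift_mulShift]
    exact ZMod.isPrimitive_stdAddChar p (mul_ne_zero hc ha)
  have hsqrt : ((Real.sqrt p : ℝ) : ℂ) ^ 2 = p := by
    rw [← ofReal_pow, Real.sq_sqrt (by positivity)]
    simp
  have hquad : (χ * χ).ringHomComp GaussianInt.toComplex =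
      (quadraticChar (ZMod p)).ringHomComp (Int.castRingHom ℂ) := by
    rw [quarticChar_sq_eq hmod hχ]
    ext x
    simp [MulChar.ringHomComp_apply]
  have hρ : GaussianInt.toComplex (χ c) ^ 2 *
      gaussSum ((χ * χ).ringHomComp GaussianInt.toComplex) ψ = (Real.sqrt p : ℂ) := by
    have h := gaussSum_mulShift ((χ * χ).ringHomComp GaussianInt.toComplex)
      (ZMod.stdAddChar (N := p)) (Units.mk0 c hc)
    rw [Units.val_mk0, ← hψ] at h
    rw [← gaussSum_quadraticChar_stdAddChar hmod, ← hquad, ← h, MulChar.ringHomComp_apply,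
      MulChar.mul_apply, map_mul, sq]
  have hinv := gaussSum_mul_gaussSum_eq_card (hne.mpr h1) hprim
  have hJ := jacobiSum_mul_nontrivial (χ := χ.ringHomComp GaussianInt.toComplex)
    (φ := (χ * χ).ringHomComp GaussianInt.toComplex) (by
      rw [← MulChar.ringHomComp_mul, h3]
      exact hne.mpr (inv_ne_one.mpr h1)) ψ
  rw [← MulChar.ringHomComp_mul, h3, ← MulChar.ringHomComp_inv, jacobiSum_ringHomComp,
    jacobiSum_quarticChar_eq hdeg hcong hmod hr hχ, map_neg] at hJ
  have hneg := mul_gaussSum_inv_eq_gaussSum (χ.ringHomComp GaussianInt.toComplex)⁻¹ ψ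
  have hinv1 : (χ.ringHomComp GaussianInt.toComplex)⁻¹ (-1) = GaussianInt.toComplex (χ (-1)) := by
    rw [MulChar.inv_apply', inv_neg_one, MulChar.ringHomComp_apply]
  rw [hinv1] at hneg
  rw [ZMod.card] at hinv
  have hc4 : GaussianInt.toComplex (χ c) ^ 4 = 1 := by
    rw [← map_pow, (hχ c hc).1, map_one]
  set g := gaussSum (χ.ringHomComp GaussianInt.toComplex) ψ
  set g' := gaussSum (χ.ringHomComp GaussianInt.toComplex)⁻¹ ψ
  set gi := gaussSum (χ.ringHomComp GaussianInt.toComplex)⁻¹ ψ⁻¹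
  set gρ := gaussSum ((χ * χ).ringHomComp GaussianInt.toComplex) ψ
  set x := GaussianInt.toComplex (χ c)
  set e := GaussianInt.toComplex (χ (-1))
  set P := GaussianInt.toComplex π
  set s : ℂ := (Real.sqrt p : ℂ)
  apply mul_right_cancel₀ hp0
  have hgρ : gρ = x ^ 2 * s := by linear_combination x ^ 2 * hρ - gρ * hc4
  have hmain : g ^ 2 * gρ = -e * p * P := by
    linear_combination (-g) * hJ + g * P * hneg - e * P * hinv
  rw [hgρ] at hmain
  linear_combination x ^ 2 * s * hmain - g ^ 2 * s ^ 2 * hc4 - g ^ 2 * hsqrt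

end Residue

/-- fourth power and square formulas for quartic Gauss sums at
degree 1 primes. -/
theorem gauss_sum_powers (π : Zi) (hπ : Prime π) (hcong : lam ^ 3 ∣ π - 1)
    (p : ℕ) (hp : Nat.Prime p) (hmod : p % 4 = 1) (hdeg : Ni π = (p : ℤ)) :
    g4 1 π ^ 4 = GaussianInt.toComplex (π ^ 3 * star π) ∧
    g4 1 π ^ 2 =
      -(quarticSym (-1) π) * (quarticSym (star π) π) ^ (-2 : ℤ) *
        (Real.sqrt ((Ni π : ℝ)) : ℂ) * GaussianInt.toComplex π := by
  have : Fact p.Prime := ⟨hp⟩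
  obtain ⟨r, hr⟩ := exists_residue_hom hπ hdeg
  obtain ⟨χ, hχ⟩ := exists_quarticChar hmod r
  have hπN : Zsqrtd.norm π = p := hdeg
  have hc : r (star π) ≠ 0 := by
    intro h
    obtain ⟨w, hw⟩ := (hr _).mp h
    have hre : ((2 * π.re : ℤ) : ZMod p) = 0 := by rw [← residue_two_re hr, h]
    push_cast at hre
    have hre0 : (π.re : ZMod p) = 0 :=
      (mul_eq_zero.mp hre).resolve_left (two_ne_zero_of_mod_four hmod)
    rw [ZMod.intCast_zmod_eq_zero_iff_dvd] at hre0
    rw [Zsqrtd.norm_def] at hπN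
    obtain ⟨k, hk⟩ := hre0
    have hp1 := hp.one_lt
    rcases eq_or_ne k 0 with rfl | hk0
    · rw [mul_zero] at hk
      rw [hk] at hπN
      have hsq : IsSquare (p : ℤ) := ⟨π.im, by linarith⟩
      exact (Nat.prime_iff_prime_int.mp hp).not_isSquare hsq
    · have h1 : 1 ≤ k * k := by
        have := mul_self_pos.mpr hk0
        omega
      rw [hk] at hπN
      have hp2 : (1 : ℤ) < p := by exact_mod_cast hp1
      nlinarith [mul_self_nonneg π.im, mul_pos (zero_lt_one.trans hp2) (zero_lt_one.trans hp2)]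
  have hsq := gaussSum_quarticChar_sq hdeg hcong hmod hr hχ hc
  rw [← g4_one_eq_gaussSum hπ hdeg hmod hr hχ] at hsq
  have hx4 : GaussianInt.toComplex (χ (r (star π))) ^ 4 = 1 := by
    rw [← map_pow, (hχ _ hc).1, map_one]
  have he2 : GaussianInt.toComplex (χ (-1)) ^ 2 = 1 := by
    rw [← map_pow, ← map_pow]
    simp
  have hsqrt : ((Real.sqrt p : ℝ) : ℂ) ^ 2 = p := by
    rw [← ofReal_pow, Real.sq_sqrt (by positivity)]
    simp
  have hnorm : GaussianInt.toComplex π * GaussianInt.toComplex (star π) = p := by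
    rw [GaussianInt.toComplex_star, Complex.mul_conj, ← GaussianInt.intCast_complex_norm, hπN]
    simp
  constructor
  · rw [show g4 1 π ^ 4 = (g4 1 π ^ 2) ^ 2 by ring, hsq, map_mul, map_pow]
    set x := GaussianInt.toComplex (χ (r (star π)))
    set P := GaussianInt.toComplex π
    calc _ = GaussianInt.toComplex (χ (-1)) ^ 2 * x ^ 4 * ((Real.sqrt p : ℝ) : ℂ) ^ 2 * P ^ 2 := by
          ring
      _ = _ := by
          rw [he2, hx4, hsqrt, ← hnorm]
          ring
  · have hr1 : r (-1) = -1 := by rw [map_neg, map_one]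
    rw [hsq, quarticSym_eq_of_residue hπ hdeg hmod hr hχ,
      quarticSym_eq_of_residue hπ hdeg hmod hr hχ, hr1, hdeg]
    have hzpow : GaussianInt.toComplex (χ (r (star π))) ^ (-2 : ℤ) =
        GaussianInt.toComplex (χ (r (star π))) ^ 2 := by
      rw [zpow_neg, zpow_ofNat]
      exact inv_eq_of_mul_eq_one_right (by rw [← pow_add]; exact hx4)
    rw [hzpow, Int.cast_natCast]
end
end
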